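/- Let M be an o-minimal structure and let S be a definable family of subsets of M^n. The following are equivalent: (1) S extends to a definable n-type over M; (2) there exists a definable downward directed family of subsets of M^n that is finer than S; (3) S extends to an n-type over M that has a definable basis. -/

import Mathlib

open FirstOrder Set

/-- `M` is an o-minimal `L`-structure: a densely linearly ordered structure without endpoints,
whose order is `∅`-definable, and in which every definable (with parameters) subset of `M`
is a finite union of points and open intervals with endpoints in `M ∪ {±∞}`. -/
def IsOMinimal (L : FirstOrder.Language) (M : Type*) [L.Structure M] [LinearOrder M] : Prop :=
  Nonempty M ∧ DenselyOrdered M ∧ NoMinOrder M ∧ NoMaxOrder M ∧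
  Set.Definable (∅ : Set M) L {v : Fin 2 → M | v 0 < v 1} ∧
  ∀ s : Set M, Set.Definable₁ (Set.univ : Set M) L s →
    ∃ F : Finset (Set M), s = ⋃₀ (F : Set (Set M)) ∧
      ∀ t ∈ F, (∃ a : M, t = {a}) ∨ (∃ a b : M, t = Set.Ioo a b) ∨
        (∃ a : M, t = Set.Ioi a) ∨ (∃ a : M, t = Set.Iio a) ∨ t = Set.univ

/-- The fiber over `u` of a set `D ⊆ M^{m+n}`, i.e. the set `φ(u, M^n)`. -/
def famFiber {M : Type*} {m n : ℕ} (D : Set (Fin m ⊕ Fin n → M)) (u : Fin m → M) :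
    Set (Fin n → M) :=
  {v | Sum.elim u v ∈ D}

/-- An `A`-definable family of subsets of `M^n`: the family of fibers `φ(u, M^n)` for `u`
ranging over an `A`-definable index set `Ω`, where `φ` is `A`-definable. -/
def IsDefFamily (L : FirstOrder.Language) {M : Type*} [L.Structure M] (A : Set M) (n : ℕ)
    (S : Set (Set (Fin n → M))) : Prop :=
  ∃ (m : ℕ) (Ω : Set (Fin m → M)) (D : Set (Fin m ⊕ Fin n → M)),
    Set.Definable A L Ω ∧ Set.Definable A L D ∧ S = famFiber D '' Ω

/-- A family of sets is downward directed: it does not contain `∅` and any two members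
contain a common member. -/
def DirectedFam {α : Type*} (S : Set (Set α)) : Prop :=
  ∅ ∉ S ∧ ∀ X ∈ S, ∀ Y ∈ S, ∃ Z ∈ S, Z ⊆ X ∩ Y

/-- `S` is finer than `F`: every member of `F` contains a member of `S`. -/
def FinerThan {α : Type*} (S F : Set (Set α)) : Prop :=
  ∀ X ∈ F, ∃ Y ∈ S, Y ⊆ X

/-- A (complete) `n`-type over `M`: an ultrafilter on the Boolean algebra of definable
subsets of `M^n`. -/
def IsTypeOn (L : FirstOrder.Language) {M : Type*} [L.Structure M] (n : ℕ)
    (p : Set (Set (Fin n → M))) : Prop :=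
  (∀ X ∈ p, Set.Definable (Set.univ : Set M) L X) ∧
  ∅ ∉ p ∧
  (∀ X ∈ p, ∀ Y ∈ p, X ∩ Y ∈ p) ∧
  (∀ X ∈ p, ∀ Y : Set (Fin n → M), Set.Definable (Set.univ : Set M) L Y → X ⊆ Y → Y ∈ p) ∧
  (∀ X : Set (Fin n → M), Set.Definable (Set.univ : Set M) L X → X ∈ p ∨ Xᶜ ∈ p)

/-- A type `p` is `A`-definable if for every `∅`-definable `D ⊆ M^{m+n}` the set of
parameters `u` with `φ(u, M^n) ∈ p` is `A`-definable. -/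
def IsDefTypeOver (L : FirstOrder.Language) {M : Type*} [L.Structure M] (A : Set M) (n : ℕ)
    (p : Set (Set (Fin n → M))) : Prop :=
  ∀ (m : ℕ) (D : Set (Fin m ⊕ Fin n → M)), Set.Definable (∅ : Set M) L D →
    Set.Definable A L {u : Fin m → M | famFiber D u ∈ p}

/-- A family `F` is complete for a family `X` if each member of `X` either contains a member
of `F` or is disjoint from one. -/
def CompleteFor {α : Type*} (F X : Set (Set α)) : Prop :=
  ∀ Y ∈ X, ∃ Z ∈ F, Z ⊆ Y ∨ Z ∩ Y = ∅

/-- A family of subsets of `M^n` is complete if it decides every definable set. -/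
def IsCompleteFam (L : FirstOrder.Language) {M : Type*} [L.Structure M] (n : ℕ)
    (S : Set (Set (Fin n → M))) : Prop :=
  ∀ X : Set (Fin n → M), Set.Definable (Set.univ : Set M) L X → ∃ Z ∈ S, Z ⊆ X ∨ Z ∩ X = ∅

/-- `B` is a basis for the type `p`: a downward directed subfamily generating `p`. -/
def IsBasisOfType {α : Type*} (B p : Set (Set α)) : Prop :=
  B ⊆ p ∧ DirectedFam B ∧ ∀ Y ∈ p, ∃ Z ∈ B, Z ⊆ Y

/-- `p` has an `A`-definable basis. -/
def HasDefBasis (L : FirstOrder.Language) {M : Type*} [L.Structure M] (A : Set M) (n : ℕ)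
    (p : Set (Set (Fin n → M))) : Prop :=
  ∃ B, IsDefFamily L A n B ∧ IsBasisOfType B p

/-- `S` has a finite tame transversal: it is covered by finitely many subfamilies, each of
which extends to a definable type. -/
def HasFTT (L : FirstOrder.Language) {M : Type*} [L.Structure M] (n : ℕ)
    (S : Set (Set (Fin n → M))) : Prop :=
  ∃ (N : ℕ) (p : Fin N → Set (Set (Fin n → M))),
    (∀ i, IsTypeOn L n (p i) ∧ IsDefTypeOver L (Set.univ : Set M) n (p i)) ∧
    ∀ X ∈ S, ∃ i, X ∈ p i

/-- The `(m,n)`-property: among any `m` members of the family, some `n` have nonempty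
intersection. -/
def HasMNProperty {α : Type*} (S : Set (Set α)) (m n : ℕ) : Prop :=
  ∀ F : Finset (Set α), ↑F ⊆ S → F.card = m →
    ∃ G ⊆ F, G.card = n ∧ (⋂₀ (G : Set (Set α))).Nonempty

set_option linter.all false

universe u

open FirstOrder Set


/-- A finite power of `M`, up to a coordinate system. -/
class DSpace (M : Type u) (Γ : Type u) where
  ι : Type
  fin : Finite ι
  e : Γ ≃ (ι → M)

attribute [instance] DSpace.fin

namespace OMinAux

instance instDSpaceSelf (M : Type u) : DSpace M M := ⟨Unit, inferInstance, (Equiv.funUnique Unit M).symm⟩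
instance instDSpacePi (M : Type u) (ι : Type) [Finite ι] : DSpace M (ι → M) :=
  ⟨ι, inferInstance, Equiv.refl _⟩
instance instDSpaceProd (M : Type u) (Γ Δ : Type u) [i : DSpace M Γ] [j : DSpace M Δ] : DSpace M (Γ × Δ) :=
  ⟨i.ι ⊕ j.ι, inferInstance, (Equiv.prodCongr i.e j.e).trans (Equiv.sumArrowEquivProdArrow _ _ _).symm⟩

variable (L : FirstOrder.Language) (M : Type u) [L.Structure M]
variable {Γ Δ Θ Λ : Type u} [DSpace M Γ] [DSpace M Δ] [DSpace M Θ] [DSpace M Λ]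

def Def (P : Γ → Prop) : Prop :=
  (univ : Set M).Definable L {v : DSpace.ι M Γ → M | P (DSpace.e.symm v)}

def DMap (f : Γ → Δ) : Prop := Def L M (fun p : Γ × Δ => f p.1 = p.2)

variable {L M}

theorem Def.congr {P Q : Γ → Prop} (h : Def L M P) (hh : ∀ x, P x ↔ Q x) : Def L M Q := by
  have : P = Q := by ext x; exact hh x
  exact this ▸ h

theorem Def.and {P Q : Γ → Prop} (hP : Def L M P) (hQ : Def L M Q) : Def L M (fun x => P x ∧ Q x) :=
  Definable.inter hP hQ
theorem Def.or {P Q : Γ → Prop} (hP : Def L M P) (hQ : Def L M Q) : Def L M (fun x => P x ∨ Q x) :=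
  Definable.union hP hQ
theorem Def.not {P : Γ → Prop} (hP : Def L M P) : Def L M (fun x => ¬ P x) :=
  Definable.compl hP
theorem Def.imp {P Q : Γ → Prop} (hP : Def L M P) (hQ : Def L M Q) : Def L M (fun x => P x → Q x) :=
  (hP.not.or hQ).congr (fun x => by tauto)
theorem Def.iff {P Q : Γ → Prop} (hP : Def L M P) (hQ : Def L M Q) : Def L M (fun x => P x ↔ Q x) :=
  ((hP.imp hQ).and (hQ.imp hP)).congr (fun x => by tauto)
theorem Def.cst (p : Prop) : Def L M (fun _ : Γ => p) := by
  by_cases h : p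
  · have : {v : DSpace.ι M Γ → M | p} = univ := by ext; simp [h]
    unfold Def; rw [this]; exact definable_univ
  · have : {v : DSpace.ι M Γ → M | p} = ∅ := by ext; simp [h]
    unfold Def; rw [this]; exact definable_empty
theorem Def.fall {κ : Type*} [Finite κ] {P : κ → Γ → Prop} (h : ∀ k, Def L M (P k)) :
    Def L M (fun x => ∀ k, P k x) := by
  have := definable_iInter_of_finite (L := L) (A := (univ : Set M)) h
  unfold Def; convert this; ext; simp
theorem Def.fex {κ : Type*} [Finite κ] {P : κ → Γ → Prop} (h : ∀ k, Def L M (P k)) :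
    Def L M (fun x => ∃ k, P k x) := by
  have := definable_iUnion_of_finite (L := L) (A := (univ : Set M)) h
  unfold Def; convert this; ext; simp

theorem Def.ren {P : Δ → Prop} (hP : Def L M P) (f : Γ → Δ) (g : DSpace.ι M Δ → DSpace.ι M Γ)
    (h : ∀ x i, DSpace.e (M := M) (f x) i = DSpace.e (M := M) x (g i)) : Def L M (fun x => P (f x)) := by
  have := Definable.preimage_comp g hP
  unfold Def; convert this using 1
  ext v
  simp only [mem_setOf_eq, mem_preimage]
  have : f (DSpace.e.symm v) = DSpace.e.symm (v ∘ g) := by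
    rw [Equiv.eq_symm_apply]; ext i; rw [h]; simp
  rw [this]

theorem Def.ex {P : Γ → Δ → Prop} (h : Def L M (fun p : Γ × Δ => P p.1 p.2)) :
    Def L M (fun x => ∃ y, P x y) := by
  have := Definable.image_comp (L := L) (A := (univ : Set M)) h (Sum.inl : DSpace.ι M Γ → DSpace.ι M Γ ⊕ DSpace.ι M Δ)
  unfold Def; convert this using 1
  ext v
  simp only [mem_setOf_eq, mem_image]
  constructor
  · rintro ⟨y, hy⟩
    refine ⟨Sum.elim v (DSpace.e y), ?_, by ext; simp⟩
    have : (DSpace.e (M := M) (Γ := Γ × Δ)).symm (Sum.elim v (DSpace.e y)) = (DSpace.e.symm v, y) := by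
      rw [Equiv.symm_apply_eq]
      ext i
      rcases i with i | i
      · exact (congrFun (Equiv.apply_symm_apply (DSpace.e (M := M) (Γ := Γ)) v) i).symm
      · rfl
    show P ((DSpace.e (M := M) (Γ := Γ × Δ)).symm (Sum.elim v (DSpace.e y))).1 _
    rw [this]; exact hy
  · rintro ⟨w, hw, rfl⟩
    exact ⟨_, hw⟩

theorem Def.all {P : Γ → Δ → Prop} (h : Def L M (fun p : Γ × Δ => P p.1 p.2)) :
    Def L M (fun x => ∀ y, P x y) :=
  (Def.ex (P := fun x y => ¬ P x y) h.not).not.congr (fun x => by push Not; rfl)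

theorem def_eq_coord (i j : DSpace.ι M Γ) :
    Def L M (fun x : Γ => DSpace.e (M := M) x i = DSpace.e (M := M) x j) := by
  unfold Def
  simp only [Equiv.apply_symm_apply]
  have := Definable.preimage_comp (L := L) (A := (univ : Set M)) (![i, j]) (s := {v : Fin 2 → M | v 0 = v 1})
    ⟨((Language.var 0 : (L[[(univ : Set M)]]).Term (Fin 2)).equal (Language.var 1)), by ext; simp⟩
  exact this

theorem def_eq_const (i : DSpace.ι M Γ) (c : M) :
    Def L M (fun x : Γ => DSpace.e (M := M) x i = c) := by
  unfold Def
  simp only [Equiv.apply_symm_apply]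
  refine ⟨(Language.var i).equal (Language.Constants.term (L.con (⟨c, mem_univ c⟩ : (univ : Set M)))), ?_⟩
  ext v; simp

theorem dmap_of_ren (f : Γ → Δ) (g : DSpace.ι M Δ → DSpace.ι M Γ)
    (h : ∀ x i, DSpace.e (M := M) (f x) i = DSpace.e (M := M) x (g i)) : DMap L M f := by
  unfold DMap
  have : Def L M (fun p : Γ × Δ => ∀ i, DSpace.e (M := M) p (Sum.inl (g i)) = DSpace.e (M := M) p (Sum.inr i)) :=
    Def.fall (fun i => def_eq_coord (L := L) (M := M) (Γ := Γ × Δ) (Sum.inl (g i)) (Sum.inr i))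
  refine this.congr (fun p => ?_)
  rw [← (DSpace.e (M := M)).injective.eq_iff, funext_iff]
  refine forall_congr' (fun i => ?_)
  rw [h]; rfl

theorem DMap.id : DMap L M (fun x : Γ => x) := dmap_of_ren _ (fun i => i) (fun _ _ => rfl)
theorem dmap_fst : DMap L M (fun x : Γ × Δ => x.1) := dmap_of_ren _ (fun i => Sum.inl i) (fun _ _ => rfl)
theorem dmap_snd : DMap L M (fun x : Γ × Δ => x.2) := dmap_of_ren _ (fun i => Sum.inr i) (fun _ _ => rfl)

theorem DMap.const (c : Δ) : DMap L M (fun _ : Γ => c) := by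
  unfold DMap
  have : Def L M (fun p : Γ × Δ => ∀ i, DSpace.e (M := M) p (Sum.inr i) = DSpace.e (M := M) c i) :=
    Def.fall (fun i => def_eq_const (L := L) (M := M) (Γ := Γ × Δ) (Sum.inr i) _)
  refine this.congr (fun p => ?_)
  rw [← (DSpace.e (M := M)).injective.eq_iff, funext_iff]
  refine forall_congr' (fun i => ?_)
  exact eq_comm

theorem Def.comp {P : Δ → Prop} {f : Γ → Δ} (hP : Def L M P) (hf : DMap L M f) :
    Def L M (fun x => P (f x)) := by
  have : Def L M (fun x : Γ => ∃ y : Δ, f x = y ∧ P y) := by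
    refine Def.ex (Def.and hf ?_)
    exact hP.ren _ (fun i => Sum.inr i) (fun _ _ => rfl)
  exact this.congr (fun x => by simp)

theorem DMap.comp {g : Δ → Θ} {f : Γ → Δ} (hg : DMap L M g) (hf : DMap L M f) :
    DMap L M (fun x => g (f x)) := by
  have : Def L M (fun p : Γ × Θ => ∃ y : Δ, f p.1 = y ∧ g y = p.2) := by
    refine Def.ex (Def.and ?_ ?_)
    · exact Def.ren hf (fun q : (Γ × Θ) × Δ => (q.1.1, q.2)) (Sum.elim (fun i => Sum.inl (Sum.inl i)) (fun i => Sum.inr i))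
        (by rintro x (i | i) <;> rfl)
    · exact Def.ren hg (fun q : (Γ × Θ) × Δ => (q.2, q.1.2)) (Sum.elim (fun i => Sum.inr i) (fun i => Sum.inl (Sum.inr i)))
        (by rintro x (i | i) <;> rfl)
  exact this.congr (fun x => by simp)

theorem DMap.prodMk {f : Γ → Δ} {g : Γ → Θ} (hf : DMap L M f) (hg : DMap L M g) :
    DMap L M (fun x => (f x, g x)) := by
  have : Def L M (fun p : Γ × (Δ × Θ) => f p.1 = p.2.1 ∧ g p.1 = p.2.2) := by
    refine Def.and ?_ ?_
    · exact Def.ren hf (fun q : Γ × (Δ × Θ) => (q.1, q.2.1)) (Sum.elim (fun i => Sum.inl i) (fun i => Sum.inr (Sum.inl i)))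
        (by rintro x (i | i) <;> rfl)
    · exact Def.ren hg (fun q : Γ × (Δ × Θ) => (q.1, q.2.2)) (Sum.elim (fun i => Sum.inl i) (fun i => Sum.inr (Sum.inr i)))
        (by rintro x (i | i) <;> rfl)
  exact this.congr (fun x => by simp [Prod.ext_iff])

theorem DMap.fst {f : Γ → Δ × Θ} (hf : DMap L M f) : DMap L M (fun x => (f x).1) := dmap_fst.comp hf
theorem DMap.snd {f : Γ → Δ × Θ} (hf : DMap L M f) : DMap L M (fun x => (f x).2) := dmap_snd.comp hf

theorem DMap.app {ι : Type} [Finite ι] {f : Γ → ι → M} (hf : DMap L M f) (i : ι) : DMap L M (fun x => f x i) :=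
  DMap.comp (g := fun v : ι → M => v i) (dmap_of_ren _ (fun _ => i) (fun _ _ => rfl)) hf

theorem DMap.eq {f g : Γ → Δ} (hf : DMap L M f) (hg : DMap L M g) : Def L M (fun x => f x = g x) :=
  Def.comp (P := fun p : Γ × Δ => f p.1 = p.2) hf (DMap.id.prodMk hg)

theorem DMap.pi {ι : Type} [Finite ι] {f : Γ → ι → M} (hf : ∀ i, DMap L M (fun x => f x i)) : DMap L M f := by
  unfold DMap
  have : Def L M (fun p : Γ × (ι → M) => ∀ i, f p.1 i = p.2 i) :=
    Def.fall (fun i => DMap.eq ((hf i).comp dmap_fst) (dmap_snd.app i))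
  exact this.congr (fun p => by rw [funext_iff])

theorem Def.comp2 {P : Δ → Θ → Prop} (hP : Def L M (fun p : Δ × Θ => P p.1 p.2)) {f : Γ → Δ} {g : Γ → Θ}
    (hf : DMap L M f) (hg : DMap L M g) : Def L M (fun x => P (f x) (g x)) :=
  Def.comp (P := fun p : Δ × Θ => P p.1 p.2) hP (hf.prodMk hg)

theorem Def.comp3 {P : Δ → Θ → Λ → Prop} (hP : Def L M (fun p : Δ × Θ × Λ => P p.1 p.2.1 p.2.2))
    {f : Γ → Δ} {g : Γ → Θ} {h : Γ → Λ}
    (hf : DMap L M f) (hg : DMap L M g) (hh : DMap L M h) : Def L M (fun x => P (f x) (g x) (h x)) :=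
  Def.comp (P := fun p : Δ × Θ × Λ => P p.1 p.2.1 p.2.2) hP (hf.prodMk (hg.prodMk hh))

theorem DMap.comp2 {P : Δ → Θ → Λ} (hP : DMap L M (fun p : Δ × Θ => P p.1 p.2)) {f : Γ → Δ} {g : Γ → Θ}
    (hf : DMap L M f) (hg : DMap L M g) : DMap L M (fun x => P (f x) (g x)) :=
  DMap.comp (g := fun p : Δ × Θ => P p.1 p.2) hP (hf.prodMk hg)

theorem DMap.cons {n : ℕ} {f : Γ → M} {g : Γ → Fin n → M} (hf : DMap L M f) (hg : DMap L M g) :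
    DMap L M (fun x => (Fin.cons (f x) (g x) : Fin (n+1) → M)) := by
  refine DMap.pi (fun i => ?_)
  refine Fin.cases ?_ (fun j => ?_) i
  · simpa using hf
  · simpa using hg.app j

theorem DMap.tail {n : ℕ} {g : Γ → Fin (n+1) → M} (hg : DMap L M g) :
    DMap L M (fun x => (Fin.tail (g x) : Fin n → M)) :=
  DMap.pi (fun i => hg.app i.succ)

theorem DMap.update {n : ℕ} {g : Γ → Fin n → M} {f : Γ → M} (i : Fin n) (hg : DMap L M g) (hf : DMap L M f) :
    DMap L M (fun x => (Function.update (g x) i (f x) : Fin n → M)) := by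
  refine DMap.pi (fun j => ?_)
  by_cases h : j = i
  · subst h; simpa using hf
  · simpa [Function.update_of_ne h] using hg.app j

theorem DMap.insertNth {n : ℕ} {g : Γ → Fin n → M} {f : Γ → M} (i : Fin (n+1)) (hg : DMap L M g) (hf : DMap L M f) :
    DMap L M (fun x => (i.insertNth (f x) (g x) : Fin (n+1) → M)) := by
  refine DMap.pi (fun j => ?_)
  refine Fin.succAboveCases i ?_ (fun k => ?_) j
  · simpa using hf
  · simpa using hg.app k

theorem DMap.removeNth {n : ℕ} {g : Γ → Fin (n+1) → M} (i : Fin (n+1)) (hg : DMap L M g) :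
    DMap L M (fun x => (i.removeNth (g x) : Fin n → M)) :=
  DMap.pi (fun j => hg.app (i.succAbove j))

end OMinAux

open FirstOrder Set
namespace OMinAux
open Filter Topology

/-- Working form of o-minimality. -/
class OM (L : FirstOrder.Language) (M : Type u) [L.Structure M] [LinearOrder M] : Prop where
  ne : Nonempty M
  dense : DenselyOrdered M
  nomin : NoMinOrder M
  nomax : NoMaxOrder M
  ltdef : Def L M (fun p : M × M => p.1 < p.2)
  fin : ∀ P : M → Prop, Def L M P → ∃ B : Finset M, ∀ a b, a ≤ b → (∀ z ∈ B, a ≤ z → z ≤ b → False) → (P a ↔ P b)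

section
variable {L : FirstOrder.Language} {M : Type u} [L.Structure M] [LinearOrder M] [OM L M]
variable {Γ Δ Θ Λ : Type u} [DSpace M Γ] [DSpace M Δ] [DSpace M Θ] [DSpace M Λ]

theorem Def.lt {f g : Γ → M} (hf : DMap L M f) (hg : DMap L M g) : Def L M (fun x => f x < g x) :=
  Def.comp2 (P := fun a b : M => a < b) OM.ltdef hf hg
theorem Def.le {f g : Γ → M} (hf : DMap L M f) (hg : DMap L M g) : Def L M (fun x => f x ≤ g x) :=
  (Def.lt hg hf).not.congr (fun x => not_lt)
theorem Def.memIoo {f g h : Γ → M} (hf : DMap L M f) (hg : DMap L M g) (hh : DMap L M h) :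
    Def L M (fun x => f x ∈ Ioo (g x) (h x)) :=
  (Def.lt hg hf).and (Def.lt hf hh)
theorem Def.ne {f g : Γ → Δ} (hf : DMap L M f) (hg : DMap L M g) : Def L M (fun x => f x ≠ g x) :=
  (DMap.eq hf hg).not

end

theorem autodef0 {p : Prop} (h : p := by
  repeat' with_reducible first
    | assumption
    | exact DMap.id
    | exact DMap.const _
    | exact Def.cst _
    | exact dmap_fst
    | exact dmap_snd
    | refine Def.and ?_ ?_
    | refine Def.or ?_ ?_
    | refine Def.not ?_
    | refine Def.lt ?_ ?_
    | refine Def.le ?_ ?_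
    | refine Def.ne ?_ ?_
    | refine DMap.eq ?_ ?_
    | refine Def.imp ?_ ?_
    | refine Def.iff ?_ ?_
    | refine Def.ex ?_
    | refine Def.all ?_
    | refine Def.memIoo ?_ ?_ ?_
    | refine DMap.fst ?_
    | refine DMap.snd ?_
    | refine DMap.prodMk ?_ ?_
    | refine DMap.cons ?_ ?_
    | refine DMap.tail ?_
    | refine DMap.update _ ?_ ?_
    | refine DMap.insertNth _ ?_ ?_
    | refine DMap.removeNth _ ?_
    | refine DMap.app ?_ _
    | refine Def.comp3 (by assumption) ?_ ?_ ?_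
    | refine Def.comp2 (by assumption) ?_ ?_
    | refine Def.comp (by assumption) ?_
    | refine DMap.comp2 (by assumption) ?_ ?_
    | refine DMap.comp (by assumption) ?_
    | refine Def.fall (fun _ => ?_)
    | refine Def.fex (fun _ => ?_)) : p := h

section
variable {L : FirstOrder.Language} {M : Type u} [L.Structure M] [LinearOrder M] [OM L M]
variable {Γ Δ Θ Λ : Type u} [DSpace M Γ] [DSpace M Δ] [DSpace M Θ] [DSpace M Λ]

end

section
variable (L : FirstOrder.Language) {M : Type u} [L.Structure M] [LinearOrder M] [OM L M]
variable {Γ Δ Θ Λ : Type u} [DSpace M Γ] [DSpace M Δ] [DSpace M Θ] [DSpace M Λ]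
variable [TopologicalSpace M] [OrderTopology M] [DenselyOrdered M] [NoMinOrder M] [NoMaxOrder M] [Nonempty M]

theorem ev_right {P : M → Prop} {x : M} : (∀ᶠ y in 𝓝[>] x, P y) ↔ ∃ b, x < b ∧ ∀ y, x < y → y < b → P y := by
  rw [Filter.Eventually, mem_nhdsGT_iff_exists_Ioo_subset]
  exact ⟨fun ⟨b, hb, h⟩ => ⟨b, hb, fun y h1 h2 => h ⟨h1, h2⟩⟩, fun ⟨b, hb, h⟩ => ⟨b, hb, fun y h1 => h y h1.1 h1.2⟩⟩
theorem ev_left {P : M → Prop} {x : M} : (∀ᶠ y in 𝓝[<] x, P y) ↔ ∃ b, b < x ∧ ∀ y, b < y → y < x → P y := by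
  rw [Filter.Eventually, mem_nhdsLT_iff_exists_Ioo_subset]
  exact ⟨fun ⟨b, hb, h⟩ => ⟨b, hb, fun y h1 h2 => h ⟨h1, h2⟩⟩, fun ⟨b, hb, h⟩ => ⟨b, hb, fun y h1 => h y h1.1 h1.2⟩⟩
theorem ev_nhds {P : M → Prop} {x : M} : (∀ᶠ y in 𝓝 x, P y) ↔ ∃ a b, a < x ∧ x < b ∧ ∀ y, a < y → y < b → P y := by
  rw [Filter.Eventually, mem_nhds_iff_exists_Ioo_subset]
  exact ⟨fun ⟨a, b, hb, h⟩ => ⟨a, b, hb.1, hb.2, fun y h1 h2 => h ⟨h1, h2⟩⟩, fun ⟨a, b, ha, hb, h⟩ => ⟨a, b, ⟨ha, hb⟩, fun y h1 => h y h1.1 h1.2⟩⟩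
theorem ev_top {P : M → Prop} : (∀ᶠ y in atTop, P y) ↔ ∃ a, ∀ y, a < y → P y := by
  rw [Filter.eventually_atTop]
  exact ⟨fun ⟨a, h⟩ => ⟨a, fun y hy => h y hy.le⟩, fun ⟨a, h⟩ => by
    obtain ⟨b, hb⟩ := exists_gt a
    exact ⟨b, fun y hy => h y (hb.trans_le hy)⟩⟩
theorem ev_bot {P : M → Prop} : (∀ᶠ y in atBot, P y) ↔ ∃ a, ∀ y, y < a → P y := by
  rw [Filter.eventually_atBot]
  exact ⟨fun ⟨a, h⟩ => ⟨a, fun y hy => h y hy.le⟩, fun ⟨a, h⟩ => by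
    obtain ⟨b, hb⟩ := exists_lt a
    exact ⟨b, fun y hy => h y (hy.trans_lt hb)⟩⟩

variable {L}

theorem Def.evR {P : Γ → M → Prop} {f : Γ → M} (hP : Def L M (fun p : Γ × M => P p.1 p.2)) (hf : DMap L M f) :
    Def L M (fun γ => ∀ᶠ y in 𝓝[>] (f γ), P γ y) := by
  simp only [ev_right]; exact autodef0
theorem Def.evL {P : Γ → M → Prop} {f : Γ → M} (hP : Def L M (fun p : Γ × M => P p.1 p.2)) (hf : DMap L M f) :
    Def L M (fun γ => ∀ᶠ y in 𝓝[<] (f γ), P γ y) := by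
  simp only [ev_left]; exact autodef0
theorem Def.evN {P : Γ → M → Prop} {f : Γ → M} (hP : Def L M (fun p : Γ × M => P p.1 p.2)) (hf : DMap L M f) :
    Def L M (fun γ => ∀ᶠ y in 𝓝 (f γ), P γ y) := by
  simp only [ev_nhds]; exact autodef0
theorem Def.evT {P : Γ → M → Prop} (hP : Def L M (fun p : Γ × M => P p.1 p.2)) :
    Def L M (fun γ => ∀ᶠ y in atTop, P γ y) := by
  simp only [ev_top]; exact autodef0
theorem Def.evB {P : Γ → M → Prop} (hP : Def L M (fun p : Γ × M => P p.1 p.2)) :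
    Def L M (fun γ => ∀ᶠ y in atBot, P γ y) := by
  simp only [ev_bot]; exact autodef0
end

theorem autodef {p : Prop} (h : p := by
  repeat' with_reducible first
    | assumption
    | exact DMap.id
    | exact DMap.const _
    | exact Def.cst _
    | exact dmap_fst
    | exact dmap_snd
    | refine Def.and ?_ ?_
    | refine Def.or ?_ ?_
    | refine Def.not ?_
    | refine Def.lt ?_ ?_
    | refine Def.le ?_ ?_
    | refine Def.ne ?_ ?_
    | refine DMap.eq ?_ ?_
    | refine Def.imp ?_ ?_
    | refine Def.iff ?_ ?_
    | refine Def.ex ?_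
    | refine Def.all ?_
    | refine Def.memIoo ?_ ?_ ?_
    | refine DMap.fst ?_
    | refine DMap.snd ?_
    | refine DMap.prodMk ?_ ?_
    | refine DMap.cons ?_ ?_
    | refine DMap.tail ?_
    | refine DMap.update _ ?_ ?_
    | refine DMap.insertNth _ ?_ ?_
    | refine DMap.removeNth _ ?_
    | refine DMap.app ?_ _
    | refine Def.evR ?_ ?_
    | refine Def.evL ?_ ?_
    | refine Def.evN ?_ ?_
    | refine Def.evT ?_
    | refine Def.evB ?_
    | refine Def.comp3 (by assumption) ?_ ?_ ?_
    | refine Def.comp2 (by assumption) ?_ ?_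
    | refine Def.comp (by assumption) ?_
    | refine DMap.comp2 (by assumption) ?_ ?_
    | refine DMap.comp (by assumption) ?_
    | refine Def.fall (fun _ => ?_)
    | refine Def.fex (fun _ => ?_)) : p := h

end OMinAux

open FirstOrder Set
namespace OMinAux
open Filter Topology
section
variable {L : FirstOrder.Language} {M : Type u} [L.Structure M] [LinearOrder M] [OM L M]
variable {Γ Δ Θ Λ : Type u} [DSpace M Γ] [DSpace M Δ] [DSpace M Θ] [DSpace M Λ]
variable [TopologicalSpace M] [OrderTopology M] [DenselyOrdered M] [NoMinOrder M] [NoMaxOrder M] [Nonempty M]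

theorem const_right {P : M → Prop} (hP : Def L M P) (x : M) :
    (∀ᶠ y in 𝓝[>] x, P y) ∨ (∀ᶠ y in 𝓝[>] x, ¬ P y) := by
  obtain ⟨B, hB⟩ := OM.fin P hP
  have h1 : ∀ᶠ y in 𝓝[>] x, ∀ z ∈ B, z ≤ x ∨ y < z := by
    rw [Filter.eventually_all_finset]
    intro z hz
    rcases le_or_gt z x with h | h
    · exact Eventually.of_forall (fun _ => Or.inl h)
    · exact ev_right.2 ⟨z, h, fun y _ h2 => Or.inr h2⟩
  obtain ⟨b, hb, h⟩ := ev_right.1 h1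
  obtain ⟨m, hm1, hm2⟩ := exists_between hb
  by_cases hPm : P m
  · left
    refine ev_right.2 ⟨m, hm1, fun y hy1 hy2 => (hB y m hy2.le fun z hz h1 h2 => ?_).2 hPm⟩
    rcases h m hm1 hm2 z hz with h3 | h3
    · exact absurd (hy1.trans_le h1) (not_lt.2 h3)
    · exact absurd h3 (not_lt.2 h2)
  · right
    refine ev_right.2 ⟨m, hm1, fun y hy1 hy2 => fun hy => hPm ((hB y m hy2.le fun z hz h1 h2 => ?_).1 hy)⟩
    rcases h m hm1 hm2 z hz with h3 | h3
    · exact absurd (hy1.trans_le h1) (not_lt.2 h3)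
    · exact absurd h3 (not_lt.2 h2)

theorem const_top {P : M → Prop} (hP : Def L M P)  :
    (∀ᶠ y in atTop, P y) ∨ (∀ᶠ y in atTop, ¬ P y) := by
  obtain ⟨B, hB⟩ := OM.fin P hP
  have h1 : ∀ᶠ y in (atTop : Filter M), ∀ z ∈ B, z < y := by
    rw [Filter.eventually_all_finset]
    intro z hz
    exact eventually_gt_atTop z
  obtain ⟨m, hm⟩ := h1.exists
  by_cases hPm : P m
  · left
    refine ev_top.2 ⟨m, fun y hy1 => (hB m y hy1.le fun z hz h1 h2 => ?_).1 hPm⟩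
    exact absurd (hm z hz) (not_lt.2 h1)
  · right
    refine ev_top.2 ⟨m, fun y hy1 => fun hy => hPm ((hB m y hy1.le fun z hz h1 h2 => ?_).2 hy)⟩
    exact absurd (hm z hz) (not_lt.2 h1)

/-- structure on the dual order -/
@[reducible]
def dualStr (L : FirstOrder.Language) (M : Type u) [i : L.Structure M] : L.Structure Mᵒᵈ := i

theorem dualOM (L : FirstOrder.Language) (M : Type u) [i : L.Structure M] [LinearOrder M] [o : OM L M] :
    @OM L Mᵒᵈ (dualStr L M) _ := by
  obtain ⟨h1, h2, h3, h4, h5, h6⟩ := o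
  have h : Def L M (fun p : M × M => p.2 < p.1) := h5.comp2 (P := fun a b : M => a < b) dmap_snd dmap_fst
  letI := dualStr L M
  refine ⟨inferInstance, inferInstance, inferInstance, inferInstance, h, fun P hP => ?_⟩
  · obtain ⟨B, hB⟩ := h6 P hP
    exact ⟨B, fun a b hab h => (hB b a hab (fun z hz h1 h2 => h z hz h2 h1)).symm⟩

theorem const_left {P : M → Prop} (hP : Def L M P) (x : M) :
    (∀ᶠ y in 𝓝[<] x, P y) ∨ (∀ᶠ y in 𝓝[<] x, ¬ P y) := by
  letI := dualStr L M
  haveI := dualOM L M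
  exact const_right (L := L) (M := Mᵒᵈ) (P := P) hP x

theorem const_bot {P : M → Prop} (hP : Def L M P) :
    (∀ᶠ y in atBot, P y) ∨ (∀ᶠ y in atBot, ¬ P y) := by
  letI := dualStr L M
  haveI := dualOM L M
  exact const_top (L := L) (M := Mᵒᵈ) (P := P) hP

theorem shrink {P : M → Prop} (hP : Def L M P) {a b : M} (hab : a < b) :
    ∃ a' b', a ≤ a' ∧ a' < b' ∧ b' ≤ b ∧ ((∀ x, a' < x → x < b' → P x) ∨ (∀ x, a' < x → x < b' → ¬ P x)) := by
  rcases const_right hP a with h | h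
  all_goals
    obtain ⟨c, hc, h⟩ := ev_right.1 h
    refine ⟨a, min c b, le_rfl, lt_min hc hab, min_le_right _ _, ?_⟩
  · exact Or.inl fun x h1 h2 => h x h1 (lt_of_lt_of_le h2 (min_le_left _ _))
  · exact Or.inr fun x h1 h2 => h x h1 (lt_of_lt_of_le h2 (min_le_left _ _))

theorem inf_interval {P : M → Prop} (hP : Def L M P) (h : {x | P x}.Infinite) :
    ∃ a b, a < b ∧ ∀ x, a < x → x < b → P x := by
  obtain ⟨B, hB⟩ := OM.fin P hP
  obtain ⟨x, hx, hxB⟩ := h.exists_notMem_finset B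
  have h1 : ∀ᶠ y in 𝓝[>] x, ∀ z ∈ B, z ≤ x ∨ y < z := by
    rw [Filter.eventually_all_finset]
    intro z hz
    rcases le_or_gt z x with h | h
    · exact Eventually.of_forall (fun _ => Or.inl h)
    · exact ev_right.2 ⟨z, h, fun y _ h2 => Or.inr h2⟩
  obtain ⟨b, hb, h⟩ := ev_right.1 h1
  refine ⟨x, b, hb, fun y h1 h2 => (hB x y h1.le fun z hz h3 h4 => ?_).1 hx⟩
  rcases h y h1 h2 z hz with h5 | h5
  · exact hxB (le_antisymm h3 h5 ▸ hz)
  · exact absurd h5 (not_lt.2 h4)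

theorem fin_of_dense {Q : M → Prop} (hQ : Def L M Q) (h : ∀ a b, a < b → ∃ t, a < t ∧ t < b ∧ Q t) :
    {t | ¬ Q t}.Finite := by
  by_contra hc
  obtain ⟨a, b, hab, h1⟩ := inf_interval hQ.not hc
  obtain ⟨t, h2, h3, h4⟩ := h a b hab
  exact h1 t h2 h3 h4


theorem cut {U : M → Prop} (hU : Def L M U) (hup : ∀ x y, x ≤ y → U x → U y) {a b : M} (ha : ¬ U a) (hb : U b) :
    ∃ s, a ≤ s ∧ s ≤ b ∧ (∀ y, s < y → U y) ∧ (∀ y, y < s → ¬ U y) := by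
  classical
  obtain ⟨B, hB⟩ := OM.fin U hU
  have hlt : ∀ x y, ¬ U x → U y → x < y := fun x y hx hy => lt_of_not_ge fun h => hx (hup _ _ h hy)
  let B1 := insert b (B.filter (fun z => U z))
  let B0 := insert a (B.filter (fun z => ¬ U z))
  have h1 : B1.Nonempty := ⟨b, by simp [B1]⟩
  have h0 : B0.Nonempty := ⟨a, by simp [B0]⟩
  set z1 := B1.min' h1
  set z0 := B0.max' h0
  have hz1 : U z1 := by
    have := B1.min'_mem h1
    simp only [B1, Finset.mem_insert, Finset.mem_filter] at this
    rcases this with h | h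
    · simp only [z1]; rw [h]; exact hb
    · exact h.2
  have hz0 : ¬ U z0 := by
    have := B0.max'_mem h0
    simp only [B0, Finset.mem_insert, Finset.mem_filter] at this
    rcases this with h | h
    · simp only [z0]; rw [h]; exact ha
    · exact h.2
  have hz1b : z1 ≤ b := B1.min'_le _ (by simp [B1])
  have hz0a : a ≤ z0 := B0.le_max' _ (by simp [B0])
  by_cases hle : ∀ y, y < z1 → ¬ U y
  · exact ⟨z1, (hlt _ _ ha hz1).le, hz1b, fun y hy => hup _ _ hy.le hz1, hle⟩
  · push Not at hle
    obtain ⟨w, hw1, hw2⟩ := hle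
    refine ⟨z0, hz0a, (hlt _ _ hz0 hb).le, fun y hy => ?_, fun y hy h => hz0 (hup _ _ hy.le h)⟩
    rcases le_or_gt w y with h | h
    · exact hup _ _ h hw2
    · refine (hB y w h.le fun z hz h3 h4 => ?_).2 hw2
      by_cases hUz : U z
      · have : z1 ≤ z := B1.min'_le _ (by simp [B1, hz, hUz])
        exact absurd (this.trans h4) (not_le.2 hw1)
      · have : z ≤ z0 := B0.le_max' _ (by simp [B0, hz, hUz])
        exact absurd (h3.trans this) (not_le.2 hy)

theorem nhds_split {P : M → Prop} {x : M} (hl : ∀ᶠ y in 𝓝[<] x, P y) (hx : P x) (hr : ∀ᶠ y in 𝓝[>] x, P y) :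
    ∀ᶠ y in 𝓝 x, P y := by
  rw [ev_left] at hl; rw [ev_right] at hr; rw [ev_nhds]
  obtain ⟨a, ha, h1⟩ := hl
  obtain ⟨b, hb, h2⟩ := hr
  refine ⟨a, b, ha, hb, fun y h3 h4 => ?_⟩
  rcases lt_trichotomy y x with h | h | h
  · exact h1 y h3 h
  · exact h ▸ hx
  · exact h2 y h h4

theorem locconst {P : M → Prop} (hP : Def L M P) {a b : M} (hab : a ≤ b)
    (h : ∀ c, a ≤ c → c ≤ b → ∀ᶠ y in 𝓝 c, (P y ↔ P c)) : P a ↔ P b := by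
  by_contra hne
  have hUd : Def L M (fun y => a ≤ y ∧ ∃ w, a ≤ w ∧ w ≤ y ∧ ¬ (P w ↔ P a)) := autodef
  obtain ⟨s, hs1, hs2, hs3, hs4⟩ := cut hUd
    (by rintro x y hxy ⟨h1, w, h2, h3, h4⟩; exact ⟨h1.trans hxy, w, h2, h3.trans hxy, h4⟩) (a := a) (b := b)
    (by rintro ⟨h1, w, h2, h3, h4⟩; have := le_antisymm h2 h3; subst this; exact h4 Iff.rfl)
    ⟨hab, b, hab, le_rfl, fun h => hne h.symm⟩
  have hPs : ∀ w, a ≤ w → w < s → (P w ↔ P a) := fun w h1 h2 => by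
    by_contra hc
    exact hs4 w h2 ⟨h1, w, h1, le_rfl, hc⟩
  obtain ⟨c, d, hc, hd, hcd⟩ := ev_nhds.1 (h s hs1 hs2)
  have hsa : P s ↔ P a := by
    rcases hs1.eq_or_lt with h1 | h1
    · rw [h1]
    · obtain ⟨w, hw1, hw2⟩ := exists_between (max_lt h1 hc)
      rw [max_lt_iff] at hw1
      rw [← hcd w hw1.2 (hw2.trans hd), hPs w hw1.1.le hw2]
  obtain ⟨w, hw1, hw2⟩ := exists_between hd
  obtain ⟨_, v, hv1, hv2, hv3⟩ := hs3 w hw1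
  apply hv3
  rcases lt_or_ge v s with h1 | h1
  · exact hPs v hv1 h1
  · rw [hcd v (hc.trans_le h1) (hv2.trans_lt hw2), hsa]

theorem bdry_finite {P : M → Prop} (hP : Def L M P) : {x | ¬ ∀ᶠ y in 𝓝 x, (P y ↔ P x)}.Finite := by
  refine fin_of_dense (L := L) (Q := fun x => ∀ᶠ y in 𝓝 x, (P y ↔ P x)) autodef ?_
  intro a b hab
  obtain ⟨a', b', h1, h2, h3, h4⟩ := shrink hP hab
  obtain ⟨t, ht1, ht2⟩ := exists_between h2
  refine ⟨t, h1.trans_lt ht1, ht2.trans_le h3, ev_nhds.2 ⟨a', b', ht1, ht2, fun y hy1 hy2 => ?_⟩⟩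
  rcases h4 with h4 | h4 <;> simp [h4 y hy1 hy2, h4 t ht1 ht2]

end
end OMinAux

open FirstOrder Set
namespace OMinAux
open Filter Topology
section
variable {L : FirstOrder.Language} {M : Type u} [L.Structure M] [LinearOrder M] [OM L M]
variable {Γ Δ Θ Λ : Type u} [DSpace M Γ] [DSpace M Δ] [DSpace M Θ] [DSpace M Λ]
variable [TopologicalSpace M] [OrderTopology M] [DenselyOrdered M] [NoMinOrder M] [NoMaxOrder M] [Nonempty M]

theorem loc_inc {N : Type u} [LinearOrder N] (f : M → N) (R : M → M → Prop) (hR : ∀ x y, R x y ↔ f x < f y)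
    (hd : Def L M (fun p : M × M => R p.1 p.2)) {a b : M}
    (hr : ∀ x, a < x → x < b → ∀ᶠ y in 𝓝[>] x, f x < f y)
    (hl : ∀ x, a < x → x < b → ∀ᶠ y in 𝓝[<] x, f y < f x) :
    ∀ x y, a < x → x < y → y < b → f x < f y := by
  intro x y hax hxy hyb
  by_contra hne
  have hUd : Def L M (fun z => ∃ w, x < w ∧ w ≤ z ∧ ¬ R x w) := autodef
  obtain ⟨s, hs1, hs2, hs3, hs4⟩ := cut hUd
    (by rintro z z' hzz ⟨w, h1, h2, h3⟩; exact ⟨w, h1, h2.trans hzz, h3⟩) (a := x) (b := y)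
    (by rintro ⟨w, h1, h2, h3⟩; exact absurd h1 (not_lt.2 h2))
    ⟨y, hxy, le_rfl, by rwa [hR]⟩
  simp only [hR] at hs3 hs4
  have hlow : ∀ w, x < w → w < s → f x < f w := fun w h1 h2 => by
    by_contra hc
    exact hs4 w h2 ⟨w, h1, le_rfl, hc⟩
  have hsb : s < b := hs2.trans_lt hyb
  have has : a < s := hax.trans_le hs1
  have hs : s = x ∨ f x < f s := by
    rcases hs1.eq_or_lt with h | h
    · exact Or.inl h.symm
    · right
      obtain ⟨c, hc, h1⟩ := ev_left.1 (hl s has hsb)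
      obtain ⟨w, hw1, hw2⟩ := exists_between (max_lt h hc)
      rw [max_lt_iff] at hw1
      exact (hlow w hw1.1 hw2).trans (h1 w hw1.2 hw2)
  obtain ⟨c, hc, h1⟩ := ev_right.1 (hr s has hsb)
  obtain ⟨w, hw1, hw2⟩ := exists_between hc
  obtain ⟨v, hv1, hv2, hv3⟩ := hs3 w hw1
  apply hv3
  rcases lt_trichotomy v s with h | h | h
  · exact hlow v hv1 h
  · subst h
    rcases hs with h2 | h2
    · exact absurd hv1 (h2 ▸ lt_irrefl _)
    · exact h2
  · have := h1 v h (hv2.trans_lt hw2)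
    rcases hs with h2 | h2
    · exact h2 ▸ this
    · exact h2.trans this

theorem psi {N : Type u} [LinearOrder N] (f : M → N) (R : M → M → Prop) (hR : ∀ x y, R x y ↔ f x < f y)
    (hd : Def L M (fun p : M × M => R p.1 p.2)) {a b : M} (hab : a < b)
    (hr : ∀ x, a < x → x < b → ∀ᶠ y in 𝓝[>] x, f x < f y)
    (hl : ∀ x, a < x → x < b → ∀ᶠ y in 𝓝[<] x, f x < f y) :
    ∃ e, a ≤ e ∧ e < b ∧ ∀ t, e < t → t < b → ∃ c, (∀ᶠ y in 𝓝[<] t, f c < f y) ∧ (∀ᶠ y in 𝓝[>] t, f y ≤ f c) := by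
  have hBd : Def L M (fun x => ∀ y, x < y → y < b → R x y) := autodef
  have hB : ∀ᶠ x in 𝓝[<] b, ¬ ∀ y, x < y → y < b → f x < f y := by
    have := const_left hBd b
    simp only [hR] at this
    refine this.resolve_left fun h => ?_
    obtain ⟨c, hc, h⟩ := ev_left.1 h
    obtain ⟨y, hy1, hy2⟩ := exists_between (max_lt hc hab)
    rw [max_lt_iff] at hy1
    obtain ⟨d, hd, h1⟩ := ev_left.1 (hl y hy1.2 hy2)
    obtain ⟨x, hx1, hx2⟩ := exists_between (max_lt hd hy1.1)
    rw [max_lt_iff] at hx1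
    exact lt_asymm (h1 x hx1.1 hx2) (h x hx1.2 (hx2.trans hy2) y hx2 hy2)
  obtain ⟨a0, ha0, hB⟩ := ev_left.1 hB
  obtain ⟨a', haa, ha0', ha'b⟩ : ∃ a', a ≤ a' ∧ a0 ≤ a' ∧ a' < b :=
    ⟨max a a0, le_max_left _ _, le_max_right _ _, max_lt hab ha0⟩
  replace hB : ∀ x, a' < x → x < b → ∃ y, x < y ∧ y < b ∧ f y ≤ f x := fun x h1 h2 => by
    have := hB x (ha0'.trans_lt h1) h2
    push Not at this
    exact this
  have hev : ∀ c, a' < c → c < b → ∀ᶠ y in 𝓝[<] b, f y ≤ f c := by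
    intro c hc1 hc2
    have hcd : Def L M (fun y => R c y) := autodef
    have := const_left hcd b
    simp only [hR, not_lt] at this
    refine this.resolve_left fun h => ?_
    obtain ⟨z0, hz0, h⟩ := ev_left.1 h
    have hUd : Def L M (fun z => ∀ y, z < y → y < b → R c y) := autodef
    obtain ⟨d, hd1, hd2, hd3, hd4⟩ := cut hUd
      (by intro z z' hzz h y h1 h2; exact h y (hzz.trans_lt h1) h2) (a := c) (b := z0)
      (by
        intro h
        obtain ⟨y, h1, h2, h3⟩ := hB c hc1 hc2
        exact absurd ((hR _ _).1 (h y h1 h2)) (not_lt.2 h3))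
      (by intro y h1 h2; exact (hR _ _).2 (h y h1 h2))
    simp only [hR] at hd3 hd4
    have hd5 : ∀ y, d < y → y < b → f c < f y := by
      intro y h1 h2
      obtain ⟨m, hm1, hm2⟩ := exists_between h1
      exact hd3 m hm1 y hm2 h2
    have had : a' < d := hc1.trans_le hd1
    have hdb : d < b := hd2.trans_lt hz0
    rcases le_or_gt (f d) (f c) with h1 | h1
    · obtain ⟨y, hy1, hy2, hy3⟩ := hB d had hdb
      exact absurd (hd5 y hy1 hy2) (not_lt.2 (hy3.trans h1))
    · obtain ⟨z, hz, h2⟩ := ev_left.1 (hl d (haa.trans_lt had) hdb)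
      refine hd4 z hz fun y h3 h4 => ?_
      rcases lt_trichotomy y d with h5 | h5 | h5
      · exact h1.trans (h2 y h3 h5)
      · exact h5 ▸ h1
      · exact hd5 y h5 h4
  have hpsi : ∀ c, a' < c → c < b → ∃ t, c < t ∧ t < b ∧ (∀ᶠ y in 𝓝[<] t, f c < f y) ∧ (∀ᶠ y in 𝓝[>] t, f y ≤ f c) := by
    intro c hc1 hc2
    obtain ⟨z0, hz0, h⟩ := ev_left.1 (hev c hc1 hc2)
    obtain ⟨e, he, h1⟩ := ev_right.1 (hr c (haa.trans_lt hc1) hc2)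
    obtain ⟨m, hm1, hm2⟩ := exists_between (lt_min he hc2)
    rw [lt_min_iff] at hm2
    have hVd : Def L M (fun z => ∀ y, z < y → y < b → ¬ R c y) := autodef
    obtain ⟨t, ht1, ht2, ht3, ht4⟩ := cut hVd
      (by intro z z' hzz h y h1 h2; exact h y (hzz.trans_lt h1) h2) (a := m) (b := z0)
      (by
        intro h
        obtain ⟨y, hy1, hy2⟩ := exists_between (lt_min hm2.1 hm2.2)
        rw [lt_min_iff] at hy2
        exact h y hy1 hy2.2 ((hR _ _).2 (h1 y (hm1.trans hy1) hy2.1)))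
      (by intro y h1 h2; rw [hR, not_lt]; exact h y h1 h2)
    simp only [hR, not_lt] at ht3 ht4
    have hct : c < t := hm1.trans_le ht1
    have htb : t < b := ht2.trans_lt hz0
    have ht5 : ∀ y, t < y → y < b → f y ≤ f c := by
      intro y h1 h2
      obtain ⟨m, hm1, hm2⟩ := exists_between h1
      exact ht3 m hm1 y hm2 h2
    refine ⟨t, hct, htb, ?_, ev_right.2 ⟨b, htb, ht5⟩⟩
    have hcd : Def L M (fun y => R c y) := autodef
    have := const_left hcd t
    simp only [hR, not_lt] at this
    refine this.resolve_right fun h => ?_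
    obtain ⟨z, hz, h⟩ := ev_left.1 h
    have h6 : f t ≤ f c := by
      by_contra h6
      rw [not_le] at h6
      obtain ⟨w, hw, h7⟩ := ev_left.1 (hl t (haa.trans_lt (hc1.trans hct)) htb)
      obtain ⟨y, hy1, hy2⟩ := exists_between (max_lt hz hw)
      rw [max_lt_iff] at hy1
      exact absurd (h6.trans (h7 y hy1.2 hy2)) (not_lt.2 (h y hy1.1 hy2))
    refine ht4 z hz fun y h3 h4 => ?_
    rcases lt_trichotomy y t with h5 | h5 | h5
    · exact h y h3 h5
    · exact h5 ▸ h6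
    · exact ht5 y h5 h4
  have hPd : Def L M (fun t => ∃ c, (∀ᶠ y in 𝓝[<] t, R c y) ∧ (∀ᶠ y in 𝓝[>] t, ¬ R c y)) := autodef
  have := const_left hPd b
  simp only [hR, not_lt] at this
  have h2 := this.resolve_right (fun h => by
    obtain ⟨z, hz, h⟩ := ev_left.1 h
    obtain ⟨c, hc1, hc2⟩ := exists_between (max_lt hz ha'b)
    rw [max_lt_iff] at hc1
    obtain ⟨t, ht1, ht2, ht3⟩ := hpsi c hc1.2 hc2
    exact h t (hc1.1.trans ht1) ht2 ⟨c, ht3⟩)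
  obtain ⟨z, hz, h⟩ := ev_left.1 h2
  exact ⟨max a z, le_max_left _ _, max_lt hab hz, fun t h1 h2 => h t ((le_max_right _ _).trans_lt h1) h2⟩

theorem no_min {N : Type u} [LinearOrder N] (f : M → N) (R : M → M → Prop) (hR : ∀ x y, R x y ↔ f x < f y)
    (hd : Def L M (fun p : M × M => R p.1 p.2)) {a b : M} (hab : a < b)
    (hr : ∀ x, a < x → x < b → ∀ᶠ y in 𝓝[>] x, f x < f y)
    (hl : ∀ x, a < x → x < b → ∀ᶠ y in 𝓝[<] x, f x < f y) : False := by
  obtain ⟨e, he1, he2, h⟩ := psi f R hR hd hab hr hl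
  have h2 : ∃ e', b ≥ e' ∧ e' > e ∧ ∀ t, e' > t → t > e → ∃ c, (∀ᶠ y in 𝓝[>] t, f c < f y) ∧ (∀ᶠ y in 𝓝[<] t, f y ≤ f c) := by
    letI := dualStr L M
    haveI := dualOM L M
    exact psi (L := L) (M := Mᵒᵈ) f R hR hd (a := b) (b := e) he2
      (fun x h1 h2 => hl x (he1.trans_lt h2) h1) (fun x h1 h2 => hr x (he1.trans_lt h2) h1)
  obtain ⟨e', h3, h4, h5⟩ := h2
  obtain ⟨t, ht1, ht2⟩ := exists_between h4
  obtain ⟨c, hc1, hc2⟩ := h t ht1 (ht2.trans_le h3)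
  obtain ⟨d, hd1, hd2⟩ := h5 t ht2 ht1
  obtain ⟨y, hy1, hy2⟩ := (hc1.and hd2).exists
  obtain ⟨z, hz1, hz2⟩ := (hc2.and hd1).exists
  exact absurd (hy1.trans_le hy2) (not_lt.2 (hz2.trans_le hz1).le)

theorem cont_of_mono (f : M → M) (hf : DMap L M f) {a b : M} (hab : a < b)
    (h : (∀ x y, a < x → x < y → y < b → f x < f y) ∨ (∀ x y, a < x → x < y → y < b → f y < f x)) :
    ∃ t, a < t ∧ t < b ∧ ∀ u v, u < f t → f t < v → ∀ᶠ x in 𝓝 t, u < f x ∧ f x < v := by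
  have hid : Def L M (fun y => ∃ x, a < x ∧ x < b ∧ f x = y) := autodef
  have hinf : {y | ∃ x, a < x ∧ x < b ∧ f x = y}.Infinite := by
    have : {y | ∃ x, a < x ∧ x < b ∧ f x = y} = f '' Ioo a b := by
      ext y; simp [and_assoc]
    rw [this]
    refine (Ioo_infinite hab).image ?_
    intro x hx y hy hxy
    by_contra hne
    rcases lt_or_gt_of_ne hne with h1 | h1 <;> rcases h with h | h
    · exact (h x y hx.1 h1 hy.2).ne hxy
    · exact (h x y hx.1 h1 hy.2).ne hxy.symm
    · exact (h y x hy.1 h1 hx.2).ne hxy.symm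
    · exact (h y x hy.1 h1 hx.2).ne hxy
  obtain ⟨c, d, hcd, hI⟩ := inf_interval hid hinf
  obtain ⟨y, hy1, hy2⟩ := exists_between hcd
  obtain ⟨t, ht1, ht2, rfl⟩ := hI y hy1 hy2
  refine ⟨t, ht1, ht2, fun u v hu hv => ?_⟩
  obtain ⟨u', hu1, hu2⟩ := exists_between (max_lt hu hy1)
  obtain ⟨v', hv1, hv2⟩ := exists_between (lt_min hv hy2)
  rw [max_lt_iff] at hu1
  rw [lt_min_iff] at hv2
  obtain ⟨x1, h11, h12, rfl⟩ := hI u' hu1.2 (hu2.trans hy2)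
  obtain ⟨x2, h21, h22, rfl⟩ := hI v' (hy1.trans hv1) hv2.2
  rw [ev_nhds]
  rcases h with h | h
  · refine ⟨x1, x2, ?_, ?_, fun z h1 h2 => ?_⟩
    · by_contra hc
      rcases (not_lt.1 hc).eq_or_lt with h3 | h3
      · exact hu2.ne (h3 ▸ rfl)
      · exact lt_asymm hu2 (h _ _ ht1 h3 h12)
    · by_contra hc
      rcases (not_lt.1 hc).eq_or_lt with h3 | h3
      · exact hv1.ne (h3 ▸ rfl)
      · exact lt_asymm hv1 (h _ _ h21 h3 ht2)
    · exact ⟨hu1.1.trans (h _ _ h11 h1 (h2.trans h22)), (h _ _ (h11.trans h1) h2 h22).trans hv2.1⟩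
  · refine ⟨x2, x1, ?_, ?_, fun z h1 h2 => ?_⟩
    · by_contra hc
      rcases (not_lt.1 hc).eq_or_lt with h3 | h3
      · exact hv1.ne (h3 ▸ rfl)
      · exact lt_asymm hv1 (h _ _ ht1 h3 h22)
    · by_contra hc
      rcases (not_lt.1 hc).eq_or_lt with h3 | h3
      · exact hu2.ne (h3 ▸ rfl)
      · exact lt_asymm hu2 (h _ _ h11 h3 ht2)
    · exact ⟨hu1.1.trans (h _ _ (h21.trans h1) h2 h12), (h _ _ h21 h1 (h2.trans h12)).trans hv2.1⟩

theorem cont_cofinite (f : M → M) (hf : DMap L M f) :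
    {t | ¬ ∀ u v, u < f t → f t < v → ∀ᶠ x in 𝓝 t, u < f x ∧ f x < v}.Finite := by
  refine fin_of_dense (L := L) (Q := fun t => ∀ u v, u < f t → f t < v → ∀ᶠ x in 𝓝 t, u < f x ∧ f x < v) autodef ?_
  intro a b hab
  by_cases hconst : ∃ c d e, a ≤ c ∧ c < d ∧ d ≤ b ∧ ∀ x, c < x → x < d → f x = e
  · obtain ⟨c, d, e, hac, hcd, hdb, h⟩ := hconst
    obtain ⟨t, ht1, ht2⟩ := exists_between hcd
    refine ⟨t, hac.trans_lt ht1, ht2.trans_le hdb, fun u v hu hv => ev_nhds.2 ⟨c, d, ht1, ht2, fun y h1 h2 => ?_⟩⟩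
    rw [h y h1 h2, ← h t ht1 ht2]; exact ⟨hu, hv⟩
  push Not at hconst
  -- one-sided dichotomies
  have hR : ∀ x, a < x → x < b → (¬ ∀ᶠ y in 𝓝[>] x, f x < f y) → ∀ᶠ y in 𝓝[>] x, f y < f x := by
    intro x hax hxb hn
    have h1 : Def L M (fun y => f x < f y) := autodef
    have h2 : Def L M (fun y => f y < f x) := autodef
    refine (const_right h2 x).resolve_right fun h3 => ?_
    have h4 := (const_right h1 x).resolve_left hn
    obtain ⟨d, hd, h5⟩ := ev_right.1 (h3.and h4)
    obtain ⟨y, hy1, hy2, hy3⟩ := hconst x (min d b) (f x) hax.le (lt_min hd hxb) (min_le_right _ _)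
    obtain ⟨h6, h7⟩ := h5 y hy1 (hy2.trans_le (min_le_left _ _))
    exact hy3 (le_antisymm (not_lt.1 h7) (not_lt.1 h6))
  have hL : ∀ x, a < x → x < b → (¬ ∀ᶠ y in 𝓝[<] x, f x < f y) → ∀ᶠ y in 𝓝[<] x, f y < f x := by
    intro x hax hxb hn
    have h1 : Def L M (fun y => f x < f y) := autodef
    have h2 : Def L M (fun y => f y < f x) := autodef
    refine (const_left h2 x).resolve_right fun h3 => ?_
    have h4 := (const_left h1 x).resolve_left hn
    obtain ⟨d, hd, h5⟩ := ev_left.1 (h3.and h4)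
    obtain ⟨y, hy1, hy2, hy3⟩ := hconst (max d a) x (f x) (le_max_right _ _) (max_lt hd hax) hxb.le
    obtain ⟨h6, h7⟩ := h5 y ((le_max_left _ _).trans_lt hy1) hy2
    exact hy3 (le_antisymm (not_lt.1 h7) (not_lt.1 h6))
  have d1 : Def L M (fun x => ∀ᶠ y in 𝓝[>] x, f x < f y) := autodef
  have d2 : Def L M (fun x => ∀ᶠ y in 𝓝[<] x, f x < f y) := autodef
  have d3 : Def L M (fun p : M × M => f p.1 < f p.2) := autodef
  have d4 : Def L M (fun p : M × M => f p.2 < f p.1) := autodef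
  obtain ⟨a1, b1, h11, h12, h13, h14⟩ := shrink d1 hab
  obtain ⟨a2, b2, h21, h22, h23, h24⟩ := shrink d2 h12
  have ha : ∀ x, a2 < x → a1 < x := fun x h => h21.trans_lt h
  have hb : ∀ x, x < b2 → x < b1 := fun x h => h.trans_le h23
  have ha' : ∀ x, a2 < x → a < x := fun x h => h11.trans_lt (h21.trans_lt h)
  have hb' : ∀ x, x < b2 → x < b := fun x h => (h.trans_le h23).trans_le h13
  suffices hs : (∀ x y, a2 < x → x < y → y < b2 → f x < f y) ∨ (∀ x y, a2 < x → x < y → y < b2 → f y < f x) by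
    obtain ⟨t, h1, h2, h3⟩ := cont_of_mono f hf h22 hs
    exact ⟨t, ha' t h1, hb' t h2, h3⟩
  rcases h14 with h14 | h14 <;> rcases h24 with h24 | h24
  · exact (no_min f (fun x y => f x < f y) (fun _ _ => Iff.rfl) d3 h22 (fun x h1 h2 => h14 x (ha x h1) (hb x h2)) h24).elim
  · left
    exact loc_inc f (fun x y => f x < f y) (fun _ _ => Iff.rfl) d3 (fun x h1 h2 => h14 x (ha x h1) (hb x h2))
      (fun x h1 h2 => hL x (ha' x h1) (hb' x h2) (h24 x h1 h2))
  · right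
    exact loc_inc (N := Mᵒᵈ) f (fun x y => f y < f x) (fun _ _ => Iff.rfl) d4
      (fun x h1 h2 => hR x (ha' x h1) (hb' x h2) (h14 x (ha x h1) (hb x h2))) h24
  · exact (no_min (N := Mᵒᵈ) f (fun x y => f y < f x) (fun _ _ => Iff.rfl) d4 h22
      (fun x h1 h2 => hR x (ha' x h1) (hb' x h2) (h14 x (ha x h1) (hb x h2)))
      (fun x h1 h2 => hL x (ha' x h1) (hb' x h2) (h24 x h1 h2))).elim

/-- Lemma A: down-closed one-parameter families vary continuously at cofinitely many parameters. -/
theorem lemmaA (P : M → M → Prop) (hP : Def L M (fun p : M × M => P p.1 p.2))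
    (hdn : ∀ t y y', y ≤ y' → P t y' → P t y) :
    {t0 | ¬ ∀ y, (∀ᶠ z in 𝓝 y, (P t0 z ↔ P t0 y)) → ∀ᶠ t in 𝓝 t0, (P t y ↔ P t0 y)}.Finite := by
  have dE : Def L M (fun t => ∀ y, ¬ P t y) := autodef
  have dF : Def L M (fun t => ∀ y, P t y) := autodef
  let G : M → M → Prop := fun t s => ((∃ y, ¬ P t y) ∧ (∃ y, P t y) ∧ (∀ y, y < s → P t y) ∧ (∀ y, s < y → ¬ P t y)) ∨
    (((∀ y, ¬ P t y) ∨ (∀ y, P t y)) ∧ s = t)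
  have hGd : Def L M (fun p : M × M => G p.1 p.2) := by simp only [G]; exact autodef
  have hGex : ∀ t, ∃ s, G t s := by
    intro t
    by_cases h1 : ∀ y, ¬ P t y
    · exact ⟨t, Or.inr ⟨Or.inl h1, rfl⟩⟩
    by_cases h2 : ∀ y, P t y
    · exact ⟨t, Or.inr ⟨Or.inr h2, rfl⟩⟩
    push Not at h1 h2
    obtain ⟨b, hb⟩ := h1
    obtain ⟨c, hc⟩ := h2
    have hd : Def L M (fun y => ¬ P t y) := autodef
    obtain ⟨s, _, _, h3, h4⟩ := cut hd (fun x y hxy h h' => h (hdn t x y hxy h')) (a := b) (b := c) (not_not.2 hb) hc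
    exact ⟨s, Or.inl ⟨⟨c, hc⟩, ⟨b, hb⟩, fun y hy => not_not.1 (h4 y hy), h3⟩⟩
  choose f hf using hGex
  have huniq : ∀ t s s', G t s → G t s' → s = s' := by
    have key : ∀ t s s', G t s → G t s' → ¬ s < s' := by
      rintro t s s' (⟨⟨y1, hy1⟩, ⟨y2, hy2⟩, h1, h2⟩ | ⟨h1 | h1, rfl⟩) (⟨⟨z1, hz1⟩, ⟨z2, hz2⟩, h3, h4⟩ | ⟨h3 | h3, rfl⟩) hlt
      · obtain ⟨m, hm1, hm2⟩ := exists_between hlt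
        exact h2 m hm1 (h3 m hm2)
      · exact h3 _ hy2
      · exact hy1 (h3 _)
      · exact h1 _ hz2
      · exact lt_irrefl _ hlt
      · exact lt_irrefl _ hlt
      · exact hz1 (h1 _)
      · exact lt_irrefl _ hlt
      · exact lt_irrefl _ hlt
    intro t s s' h h'
    exact le_antisymm (not_lt.1 (key t s' s h' h)) (not_lt.1 (key t s s' h h'))
  have hfd : DMap L M f := by
    unfold DMap
    exact hGd.congr (fun p => ⟨fun h => huniq _ _ _ (hf p.1) h, fun h => h ▸ hf p.1⟩)
  refine (((bdry_finite dE).union (bdry_finite dF)).union (cont_cofinite f hfd)).subset ?_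
  intro t0 ht0
  by_contra hc
  simp only [mem_union, mem_setOf_eq, not_or, not_not] at hc
  obtain ⟨⟨hE, hF⟩, hcont⟩ := hc
  apply ht0
  intro y hy
  by_cases h1 : ∀ y, ¬ P t0 y
  · filter_upwards [hE] with t ht
    simp [ht.2 h1 y, h1 y]
  by_cases h2 : ∀ y, P t0 y
  · filter_upwards [hF] with t ht
    simp [ht.2 h2 y, h2 y]
  have hG : ∀ t, ¬ (∀ y, ¬ P t y) → ¬ (∀ y, P t y) → (∀ y, y < f t → P t y) ∧ (∀ y, f t < y → ¬ P t y) := by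
    intro t h1 h2
    rcases hf t with h | h
    · exact h.2.2
    · tauto
  have h0 := hG t0 h1 h2
  obtain ⟨c, d, hc, hd, hcd⟩ := ev_nhds.1 hy
  obtain ⟨y1, hy11, hy12⟩ := exists_between hc
  obtain ⟨y2, hy21, hy22⟩ := exists_between hd
  obtain ⟨lo, hlo⟩ := exists_lt (f t0)
  obtain ⟨hi, hhi⟩ := exists_gt (f t0)
  rcases lt_or_ge y (f t0) with h | h
  · filter_upwards [hE, hF, hcont y hi h hhi] with t h3 h4 h5
    have := (hG t (by rwa [h3]) (by rwa [h4])).1 y h5.1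
    simp [this, h0.1 y h]
  · have h6 : f t0 < y := by
      refine lt_of_le_of_ne h fun he => ?_
      have h7 : P t0 y1 := h0.1 y1 (he ▸ hy12)
      have h8 : ¬ P t0 y2 := h0.2 y2 (he ▸ hy21)
      rw [hcd y1 hy11 (hy12.trans hd)] at h7
      rw [hcd y2 (hc.trans hy21) hy22] at h8
      exact h8 h7
    filter_upwards [hE, hF, hcont lo y hlo h6] with t h3 h4 h5
    have := (hG t (by rwa [h3]) (by rwa [h4])).2 y h5.2
    simp [this, h0.2 y h6]

end
end OMinAux

open FirstOrder Set
namespace OMinAux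
open Filter Topology
section
variable {L : FirstOrder.Language} {M : Type u} [L.Structure M] [LinearOrder M] [OM L M]
variable {Γ Δ Θ Λ : Type u} [DSpace M Γ] [DSpace M Δ] [DSpace M Θ] [DSpace M Λ]
variable [TopologicalSpace M] [OrderTopology M] [DenselyOrdered M] [NoMinOrder M] [NoMaxOrder M] [Nonempty M]

/-- Goodness of a point of the plane w.r.t. a finite-fibered relation. -/
def Gd (D : M → M → Prop) (t0 y : M) : Prop :=
  (¬ D t0 y → ∃ c d, c < y ∧ y < d ∧ ∀ᶠ t in 𝓝 t0, ∀ z, c < z → z < d → ¬ D t z) ∧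
  (D t0 y → (∀ c d, c < y → y < d → ∀ᶠ t in 𝓝 t0, ∃ z, c < z ∧ z < d ∧ D t z) ∧
    ∃ c d, c < y ∧ y < d ∧ ∀ᶠ t in 𝓝 t0, ∀ z z', c < z → z < d → c < z' → z' < d → D t z → D t z' → z = z')

def good (D : M → M → Prop) (t0 : M) : Prop :=
  (∀ y, Gd D t0 y) ∧ (∃ c, ∀ᶠ t in 𝓝 t0, ∀ y, y < c → ¬ D t y) ∧ (∃ c, ∀ᶠ t in 𝓝 t0, ∀ y, c < y → ¬ D t y)

theorem def_Gd {D : Γ → M → M → Prop} (hD : Def L M (fun p : Γ × M × M => D p.1 p.2.1 p.2.2)) :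
    Def L M (fun p : Γ × M × M => Gd (D p.1) p.2.1 p.2.2) := by
  unfold Gd; exact autodef

theorem def_good {D : Γ → M → M → Prop} (hD : Def L M (fun p : Γ × M × M => D p.1 p.2.1 p.2.2)) :
    Def L M (fun p : Γ × M => good (D p.1) p.2) := by
  have := def_Gd hD
  have h : Def L M (fun q : (Γ × M) × M => Gd (D q.1.1) q.1.2 q.2) :=
    Def.comp3 (P := fun a b c => Gd (D a) b c) this autodef autodef autodef
  unfold good; exact autodef

def IsB (P : M → M → Prop) (t y : M) : Prop := (∀ z, z < y → P t z) ∧ (∀ z, y < z → ¬ P t z)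

theorem IsB.uniq {P : M → M → Prop} {t y y' : M} (h : IsB P t y) (h' : IsB P t y') : y = y' := by
  rcases lt_trichotomy y y' with h1 | h1 | h1
  · obtain ⟨m, hm1, hm2⟩ := exists_between h1
    exact absurd (h'.1 m hm2) (h.2 m hm1)
  · exact h1
  · obtain ⟨m, hm1, hm2⟩ := exists_between h1
    exact absurd (h.1 m hm2) (h'.2 m hm1)

theorem lemmaB (D : M → M → Prop) (hD : Def L M (fun p : M × M => D p.1 p.2)) (hfin : ∀ t, {y | D t y}.Finite)
    (P : M → M → Prop) (hP : Def L M (fun p : M × M => P p.1 p.2))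
    (hdn : ∀ t y y', y ≤ y' → P t y' → P t y) :
    {t0 | ¬ ∀ β, IsB P t0 β → ∃ c d, c < β ∧ β < d ∧ ∀ y, c < y → y < d → Gd D t0 y}.Finite := by
  have dE : Def L M (fun t => ∃ y, D t y ∧ IsB P t y) := by unfold IsB; exact autodef
  have a1 := lemmaA P hP hdn
  have a2 := lemmaA (L := L) (fun t z => ∃ y, D t y ∧ (∃ w, y < w ∧ P t w) ∧ z ≤ y) autodef
    (by rintro t y y' hy ⟨w, h1, h2, h3⟩; exact ⟨w, h1, h2, hy.trans h3⟩)
  have a3 := lemmaA (L := L) (fun t z => ∀ y, D t y → (∃ w, w < y ∧ ¬ P t w) → z < y) autodef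
    (by intro t y y' hy h w h1 h2; exact hy.trans_lt (h w h1 h2))
  refine (((bdry_finite dE).union a1).union (a2.union a3)).subset ?_
  intro t0 ht0
  by_contra hc
  simp only [mem_union, mem_setOf_eq, not_or, not_not] at hc
  obtain ⟨⟨hE, h1⟩, h2, h3⟩ := hc
  clear a1 a2 a3
  apply ht0
  intro β hβ
  have hfin' : ∀ᶠ y in 𝓝 β, D t0 y → y = β := by
    have : ({y | D t0 y} \ {β}).Finite := (hfin t0).subset diff_subset
    filter_upwards [this.isClosed.isOpen_compl.mem_nhds (by simp)] with y hy hDy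
    by_contra hne
    exact hy ⟨hDy, hne⟩
  obtain ⟨c, d, hc, hd, hcd⟩ := ev_nhds.1 hfin'
  obtain ⟨c', hc1, hc2⟩ := exists_between hc
  obtain ⟨d', hd1, hd2⟩ := exists_between hd
  have hlow : ∀ y, y < β → ∀ᶠ t in 𝓝 t0, P t y := by
    intro y hy
    have h4 := h1 y (by
      filter_upwards [Iio_mem_nhds hy] with z hz
      simp [hβ.1 z hz, hβ.1 y hy])
    filter_upwards [h4] with t ht
    exact ht.2 (hβ.1 y hy)
  have hhigh : ∀ y, β < y → ∀ᶠ t in 𝓝 t0, ¬ P t y := by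
    intro y hy
    have h4 := h1 y (by
      filter_upwards [Ioi_mem_nhds hy] with z hz
      simp [hβ.2 z hz, hβ.2 y hy])
    filter_upwards [h4] with t ht
    exact fun h => hβ.2 y hy (ht.1 h)
  have hm : ∀ z, c < z → z < β → ¬ ∃ y, D t0 y ∧ (∃ w, y < w ∧ P t0 w) ∧ z ≤ y := by
    rintro z hz1 hz2 ⟨y, hy1, ⟨w, hw1, hw2⟩, hy3⟩
    have hyb : y < β := by
      by_contra hn
      exact hβ.2 w ((not_lt.1 hn).trans_lt hw1) hw2
    exact hyb.ne (hcd y (hz1.trans_le hy3) (hyb.trans hd) hy1)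
  have hp : ∀ z, β < z → z < d → ∀ y, D t0 y → (∃ w, w < y ∧ ¬ P t0 w) → z < y := by
    rintro z hz1 hz2 y hy1 ⟨w, hw1, hw2⟩
    have hyb : β < y := by
      by_contra hn
      exact hw2 (hβ.1 w (hw1.trans_le (not_lt.1 hn)))
    by_contra hn
    exact hyb.ne' (hcd y (hc.trans hyb) ((not_lt.1 hn).trans_lt hz2) hy1)
  have e2 := h2 c' (by
    filter_upwards [Ioo_mem_nhds hc1 hc2] with z hz
    simp only [hm z hz.1 hz.2, hm c' hc1 hc2])
  have e3 := h3 d' (by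
    filter_upwards [Ioo_mem_nhds hd1 hd2] with z hz
    exact ⟨fun _ => hp d' hd1 hd2, fun _ => hp z hz.1 hz.2⟩)
  have hB : ∀ᶠ t in 𝓝 t0, ∀ y, c' < y → y < d' → D t y → IsB P t y := by
    filter_upwards [e2, e3] with t h4 h5 y hy1 hy2 hDy
    refine ⟨fun z hz => ?_, fun z hz hPz => ?_⟩
    · by_contra hPz
      exact absurd (h5.2 (hp d' hd1 hd2) y hDy ⟨z, hz, hPz⟩) (not_lt.2 hy2.le)
    · exact hm c' hc1 hc2 (h4.1 ⟨y, hDy, ⟨z, hz, hPz⟩, hy1.le⟩)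
  have hB0 := hB.self_of_nhds
  refine ⟨c', d', hc2, hd1, fun y hy1 hy2 => ?_⟩
  rcases lt_trichotomy y β with hy | hy | hy
  · refine ⟨fun _ => ?_, fun h => absurd ((hB0 y hy1 hy2 h).uniq hβ) hy.ne⟩
    obtain ⟨m, hm1, hm2⟩ := exists_between hy
    refine ⟨c', m, hy1, hm1, ?_⟩
    filter_upwards [hB, hlow m hm2] with t h4 h5 z hz1 hz2 hDz
    exact (h4 z hz1 (hz2.trans (hm2.trans hd1)) hDz).2 m hz2 h5
  · subst hy
    refine ⟨fun hn => ⟨c', d', hy1, hy2, ?_⟩, fun hDy => ⟨fun c1 d1 hc1 hd1 => ?_, c', d', hy1, hy2, ?_⟩⟩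
    · have hE0 : ¬ ∃ z, D t0 z ∧ IsB P t0 z := by
        rintro ⟨z, hz1, hz2⟩
        exact hn (hz2.uniq hβ ▸ hz1)
      filter_upwards [hE, hB] with t h4 h5 z hz1 hz2 hDz
      exact hE0 (h4.1 ⟨z, hDz, h5 z hz1 hz2 hDz⟩)
    · obtain ⟨m1, hm11, hm12⟩ := exists_between hc1
      obtain ⟨m2, hm21, hm22⟩ := exists_between hd1
      filter_upwards [hE, hlow m1 hm12, hhigh m2 hm21] with t h4 h5 h6
      obtain ⟨z, hz1, hz2⟩ := h4.2 ⟨y, hDy, hβ⟩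
      refine ⟨z, ?_, ?_, hz1⟩
      · by_contra hn
        exact hz2.2 m1 ((not_lt.1 hn).trans_lt hm11) h5
      · by_contra hn
        exact h6 (hz2.1 m2 (hm22.trans_le (not_lt.1 hn)))
    · filter_upwards [hB] with t h4 z z' hz1 hz2 hz1' hz2' hDz hDz'
      exact (h4 z hz1 hz2 hDz).uniq (h4 z' hz1' hz2' hDz')
  · refine ⟨fun _ => ?_, fun h => absurd ((hB0 y hy1 hy2 h).uniq hβ) hy.ne'⟩
    obtain ⟨m, hm1, hm2⟩ := exists_between hy
    refine ⟨m, d', hm2, hy2, ?_⟩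
    filter_upwards [hB, hhigh m hm1] with t h4 h5 z hz1 hz2 hDz
    exact h5 ((h4 z (hc2.trans (hm1.trans hz1)) hz2 hDz).1 m hz1)

theorem good_cofinite (D : M → M → Prop) (hD : Def L M (fun p : M × M => D p.1 p.2)) (hfin : ∀ t, {y | D t y}.Finite) :
    {t | ¬ good D t}.Finite := by
  have hDG : Def L M (fun p : M × M => Gd D p.1 p.2) := by unfold Gd; exact autodef
  have a1 := lemmaB (L := L) D hD hfin (fun t z => ∀ w, ¬ Gd D t w → z < w) autodef
    (by intro t y y' hy h w hw; exact hy.trans_lt (h w hw))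
  have a2 := lemmaA (L := L) (fun t z => ∀ y, D t y → z ≤ y) autodef
    (by intro t y y' hy h w hw; exact hy.trans (h w hw))
  have a3 := lemmaA (L := L) (fun t z => ∃ y, D t y ∧ z ≤ y) autodef
    (by rintro t y y' hy ⟨w, h1, h2⟩; exact ⟨w, h1, hy.trans h2⟩)
  refine (a1.union (a2.union a3)).subset ?_
  intro t0 ht0
  by_contra hc
  simp only [mem_union, mem_setOf_eq, not_or, not_not] at hc
  obtain ⟨h1, h2, h3⟩ := hc
  clear a1 a2 a3
  apply ht0
  have g2 : ∃ c, ∀ᶠ t in 𝓝 t0, ∀ y, y < c → ¬ D t y := by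
    obtain ⟨b, hb⟩ := (hfin t0).bddBelow
    obtain ⟨c, hc⟩ := exists_lt b
    have hcb : ∀ z, z < b → ∀ y, D t0 y → z ≤ y := fun z hz y hy => hz.le.trans (hb hy)
    refine ⟨c, ?_⟩
    have := h2 c (by
      filter_upwards [Iio_mem_nhds hc] with z hz
      exact ⟨fun _ => hcb c hc, fun _ => hcb z hz⟩)
    filter_upwards [this] with t ht y hy hDy
    exact absurd (ht.2 (hcb c hc) y hDy) (not_le.2 hy)
  have g3 : ∃ c, ∀ᶠ t in 𝓝 t0, ∀ y, c < y → ¬ D t y := by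
    obtain ⟨b, hb⟩ := (hfin t0).bddAbove
    obtain ⟨c, hc⟩ := exists_gt b
    have hcb : ∀ z, b < z → ¬ ∃ y, D t0 y ∧ z ≤ y := by
      rintro z hz ⟨y, hy1, hy2⟩
      exact absurd (hz.trans_le hy2) (not_lt.2 (hb hy1))
    refine ⟨c, ?_⟩
    have := h3 c (by
      filter_upwards [Ioi_mem_nhds hc] with z hz
      simp only [hcb c hc, hcb z hz])
    filter_upwards [this] with t ht y hy hDy
    exact hcb c hc (ht.1 ⟨y, hDy, hy.le⟩)
  refine ⟨?_, g2, g3⟩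
  by_contra hne
  push Not at hne
  obtain ⟨w, hw⟩ := hne
  obtain ⟨c, hc⟩ := g2
  have hPc : ∀ z, z < c → ∀ w, ¬ Gd D t0 w → z < w := by
    intro z hz w hw
    by_contra hn
    apply hw
    have hwc : w < c := (not_lt.1 hn).trans_lt hz
    obtain ⟨l, hl⟩ := exists_lt w
    refine ⟨fun _ => ⟨l, c, hl, hwc, ?_⟩, fun h => absurd h (hc.self_of_nhds w hwc)⟩
    filter_upwards [hc] with t ht z _ hz
    exact ht z hz
  obtain ⟨c', hc'⟩ := exists_lt c
  have hd : Def L M (fun z => ¬ ∀ w, ¬ Gd D t0 w → z < w) := autodef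
  obtain ⟨β, _, _, hb1, hb2⟩ := cut hd
    (by intro x y hxy h h'; exact h fun w hw => hxy.trans_lt (h' w hw)) (a := c') (b := w)
    (not_not.2 (hPc c' hc')) (fun h => lt_irrefl _ (h w hw))
  obtain ⟨c, d, hc1, hd1, hcd⟩ := h1 β ⟨fun z hz => not_not.1 (hb2 z hz), hb1⟩
  obtain ⟨z, hz1, hz2⟩ := exists_between hd1
  have := hb1 z hz1
  push Not at this
  obtain ⟨v, hv1, hv2⟩ := this
  have hβv : β ≤ v := by
    by_contra hn
    obtain ⟨z', hz1', hz2'⟩ := exists_between (not_le.1 hn)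
    exact lt_asymm hz1' (not_not.1 (hb2 z' hz2') v hv1)
  exact hv1 (hcd v (hc1.trans_le hβv) (hv2.trans_lt hz2))

theorem compact_aux (E : M → M → Prop) (hE : Def L M (fun p : M × M => E p.1 p.2)) (t0 : M)
    (hb : ∃ c, ∀ᶠ t in 𝓝 t0, ∀ y, y < c → ¬ E t y) (ht : ∃ c, ∀ᶠ t in 𝓝 t0, ∀ y, c < y → ¬ E t y)
    (hl : ∀ s, ∃ c d, c < s ∧ s < d ∧ ∀ᶠ t in 𝓝 t0, ∀ y, c < y → y < d → ¬ E t y) :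
    ∀ᶠ t in 𝓝 t0, ∀ y, ¬ E t y := by
  obtain ⟨c1, hc1⟩ := hb
  obtain ⟨c2, hc2⟩ := ht
  obtain ⟨b, hbb⟩ := exists_gt c2
  by_cases hV : ∀ᶠ t in 𝓝 t0, ∀ y, y < b → ¬ E t y
  · filter_upwards [hV, hc2] with t h1 h2 y
    rcases lt_or_ge y b with h | h
    · exact h1 y h
    · exact h2 y (hbb.trans_le h)
  · exfalso
    have hd : Def L M (fun z => ¬ ∀ᶠ t in 𝓝 t0, ∀ y, y < z → ¬ E t y) := autodef
    obtain ⟨s, _, _, h1, h2⟩ := cut hd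
      (by intro x y hxy h h'; exact h (h'.mono fun t ht y hy => ht y (hy.trans_le hxy))) (a := c1) (b := b)
      (not_not.2 hc1) hV
    obtain ⟨c, d, hc, hd, hcd⟩ := hl s
    obtain ⟨m, hm1, hm2⟩ := exists_between hc
    obtain ⟨n, hn1, hn2⟩ := exists_between hd
    apply h1 n hn1
    filter_upwards [hcd, not_not.1 (h2 m hm2)] with t h3 h4 y hy
    rcases lt_or_ge y m with h | h
    · exact h4 y h
    · exact h3 y (hm1.trans_le h) (hy.trans hn2)

theorem good_const (D : M → M → Prop) (hD : Def L M (fun p : M × M => D p.1 p.2)) (hfin : ∀ t, {y | D t y}.Finite)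
    {t0 : M} (hg : good D t0) : ∀ᶠ t in 𝓝 t0, {y | D t y}.ncard = {y | D t0 y}.ncard := by
  classical
  obtain ⟨hG, hb, ht⟩ := hg
  obtain ⟨U, hU1, hU2⟩ := (hfin t0).t2_separation
  have hJ : ∀ y : {y | D t0 y}, ∃ c d, c < y.1 ∧ y.1 < d ∧ (∀ z, c < z → z < d → z ∈ U y) ∧
      (∀ᶠ t in 𝓝 t0, ∃ z, c < z ∧ z < d ∧ D t z) ∧
      ∀ᶠ t in 𝓝 t0, ∀ z z', c < z → z < d → c < z' → z' < d → D t z → D t z' → z = z' := by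
    rintro ⟨y, hy⟩
    obtain ⟨h1, c, d, hc, hd, h2⟩ := (hG y).2 hy
    obtain ⟨c', d', hc', hd', h3⟩ := ev_nhds.1 ((hU1 y).2.mem_nhds (hU1 y).1)
    refine ⟨max c c', min d d', max_lt hc hc', lt_min hd hd', fun z h4 h5 => ?_, h1 _ _ (max_lt hc hc') (lt_min hd hd'), ?_⟩
    · exact h3 z ((le_max_right _ _).trans_lt h4) (h5.trans_le (min_le_right _ _))
    · filter_upwards [h2] with t h6 z z' h7 h8 h9 h10
      exact h6 z z' ((le_max_left _ _).trans_lt h7) (h8.trans_le (min_le_left _ _))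
        ((le_max_left _ _).trans_lt h9) (h10.trans_le (min_le_left _ _))
  choose c d hc hd hU hex huq using hJ
  haveI : Finite {y | D t0 y} := hfin t0
  have hcov : ∀ᶠ t in 𝓝 t0, ∀ y, ¬ (D t y ∧ ¬ ∃ i : {y | D t0 y}, c i < y ∧ y < d i) := by
    refine compact_aux (L := L) (fun t y => D t y ∧ ¬ ∃ i : {y | D t0 y}, c i < y ∧ y < d i) ?_ t0 ?_ ?_ ?_
    · refine Def.and hD (Def.not (Def.fex fun i => ?_))
      exact autodef
    · obtain ⟨c, hc⟩ := hb
      exact ⟨c, hc.mono fun t h y hy h' => h y hy h'.1⟩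
    · obtain ⟨c, hc⟩ := ht
      exact ⟨c, hc.mono fun t h y hy h' => h y hy h'.1⟩
    · intro s
      by_cases hs : D t0 s
      · exact ⟨c ⟨s, hs⟩, d ⟨s, hs⟩, hc ⟨s, hs⟩, hd ⟨s, hs⟩, Eventually.of_forall fun t y h1 h2 h3 =>
          h3.2 ⟨⟨s, hs⟩, h1, h2⟩⟩
      · obtain ⟨c, d, h1, h2, h3⟩ := (hG s).1 hs
        exact ⟨c, d, h1, h2, h3.mono fun t h y h4 h5 h6 => h y h4 h5 h6.1⟩
  filter_upwards [hcov, eventually_all.2 hex, eventually_all.2 huq] with t h1 h2 h3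
  choose g hg1 hg2 hg3 using h2
  symm
  have : {y | D t y} = range g := by
    ext y
    constructor
    · intro hy
      have := h1 y
      push Not at this
      obtain ⟨i, hi1, hi2⟩ := this hy
      exact ⟨i, h3 i _ _ (hg1 i) (hg2 i) hi1 hi2 (hg3 i) hy⟩
    · rintro ⟨i, rfl⟩
      exact hg3 i
  rw [this, ← image_univ, ncard_image_of_injective]
  · rw [ncard_univ]; rfl
  · intro i j hij
    by_contra hne
    have hne' : i.1 ≠ j.1 := fun h => hne (Subtype.ext h)
    exact disjoint_left.1 (hU2 i.2 j.2 hne') (hU i _ (hg1 i) (hg2 i)) (hij ▸ hU j _ (hg1 j) (hg2 j))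

end
end OMinAux

open FirstOrder Set
namespace OMinAux
open Filter Topology
section
variable {L : FirstOrder.Language} {M : Type u} [L.Structure M] [LinearOrder M] [OM L M]
variable {Γ Δ Θ Λ : Type u} [DSpace M Γ] [DSpace M Δ] [DSpace M Θ] [DSpace M Λ]
variable [TopologicalSpace M] [OrderTopology M] [DenselyOrdered M] [NoMinOrder M] [NoMaxOrder M] [Nonempty M]

theorem le_ncard_iff {D : M → Prop} (hfin : {y | D y}.Finite) (k : ℕ) :
    k ≤ {y | D y}.ncard ↔ ∃ v : Fin k → M, (∀ i j, v i = v j → i = j) ∧ ∀ i, D (v i) := by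
  constructor
  · intro h
    obtain ⟨t, ht1, ht2⟩ := Set.exists_subset_card_eq h
    have htf : t.Finite := hfin.subset ht1
    haveI := htf.fintype
    have : Fintype.card t = k := by rw [← ht2, ← Nat.card_coe_set_eq, Nat.card_eq_fintype_card]
    let e := (Fintype.equivFinOfCardEq this).symm
    exact ⟨fun i => (e i).1, fun i j h => e.injective (Subtype.ext h), fun i => ht1 (e i).2⟩
  · rintro ⟨v, hv1, hv2⟩
    have h1 : range v ⊆ {y | D y} := by rintro _ ⟨i, rfl⟩; exact hv2 i
    have h2 := ncard_le_ncard h1 hfin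
    rw [← image_univ, ncard_image_of_injective _ (fun i j h => hv1 i j h), ncard_univ, Nat.card_eq_fintype_card,
      Fintype.card_fin] at h2
    exact h2

theorem def_ncard {D : Γ → M → Prop} (hD : Def L M (fun p : Γ × M => D p.1 p.2)) (hfin : ∀ x, {y | D x y}.Finite) (k : ℕ) :
    Def L M (fun x => k ≤ {y | D x y}.ncard) := by
  have : Def L M (fun x => ∃ v : Fin k → M, (∀ i j, v i = v j → i = j) ∧ ∀ i, D x (v i)) := autodef
  exact this.congr (fun x => (le_ncard_iff (hfin x) k).symm)

def FinDir {n : ℕ} (i : Fin n) (B : (Fin n → M) → Prop) : Prop := ∀ x, {t | B (Function.update x i t)}.Finite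

variable (L M) in
def UF (n : ℕ) : Prop := ∀ D : (Fin n → M) → M → Prop, Def L M (fun p : (Fin n → M) × M => D p.1 p.2) →
  (∀ x, {y | D x y}.Finite) → ∃ K, ∀ x, {y | D x y}.ncard ≤ K

variable (L M) in
def TB (n : ℕ) : Prop := ∀ A : ℕ → (Fin n → M) → Prop, (∀ k, Def L M (A k)) →
  (∀ k k' x, k ≤ k' → A k' x → A k x) → (∀ x, ∃ k, ¬ A k x) →
  (∀ i : Fin n, ∃ B : (Fin n → M) → Prop, Def L M B ∧ FinDir i B ∧
    ∀ k x, ¬ B x → ∀ᶠ t in 𝓝 (x i), (A k (Function.update x i t) ↔ A k x)) →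
  ∃ Z : Fin n → (Fin n → M) → Prop, (∀ i, Def L M (Z i)) ∧ (∀ i, FinDir i (Z i)) ∧ ∃ k, ∀ x, A k x → ∃ i, Z i x

theorem tb_zero : TB L M 0 := by
  intro A hA hanti hex _
  obtain ⟨k, hk⟩ := hex (fun i => i.elim0)
  refine ⟨fun i => i.elim0, fun i => i.elim0, fun i => i.elim0, k, fun x hx => absurd ?_ hk⟩
  convert hx

theorem uf_zero : UF L M 0 := by
  intro D hD hfin
  refine ⟨{y | D (fun i => i.elim0) y}.ncard, fun x => le_of_eq ?_⟩
  congr!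

theorem uf_of_tb {m : ℕ} (htb : TB L M (m+1)) (huf : UF L M m) : UF L M (m+1) := by
  intro D hD hfin
  have htame : ∀ i : Fin (m+1), ∃ B : (Fin (m+1) → M) → Prop, Def L M B ∧ FinDir i B ∧
    ∀ k x, ¬ B x → ∀ᶠ t in 𝓝 (x i), (k ≤ {y | D (Function.update x i t) y}.ncard ↔ k ≤ {y | D x y}.ncard) := by
    intro i
    have hDi : Def L M (fun p : (Fin (m+1) → M) × M × M => D (Function.update p.1 i p.2.1) p.2.2) := autodef
    have hg := def_good (D := fun (x : Fin (m+1) → M) t y => D (Function.update x i t) y) hDi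
    refine ⟨fun x => ¬ good (fun t y => D (Function.update x i t) y) (x i), ?_, ?_, ?_⟩
    · exact Def.not (Def.comp2 (P := fun (x : Fin (m+1) → M) t => good (fun t y => D (Function.update x i t) y) t) hg autodef autodef)
    · intro x
      simp only [Function.update_idem, Function.update_self]
      exact good_cofinite (L := L) _ autodef (fun t => hfin _)
    · intro k x hx
      rw [not_not] at hx
      have := good_const (L := L) _ autodef (fun t => hfin _) hx
      filter_upwards [this] with t ht
      rw [ht]; simp
  obtain ⟨Z, hZd, hZf, k, hk⟩ := htb (fun k x => k ≤ {y | D x y}.ncard) (fun k => def_ncard hD hfin k)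
    (fun k k' x h h' => h.trans h') (fun x => ⟨{y | D x y}.ncard + 1, by simp⟩) htame
  have hi : ∀ i : Fin (m+1), ∃ K, ∀ x, Z i x → {y | D x y}.ncard ≤ K := by
    intro i
    have hZi := hZd i
    have hfin2 : ∀ y : Fin m → M, {w | ∃ t, Z i (i.insertNth t y) ∧ D (i.insertNth t y) w}.Finite := by
      intro y
      have h1 : {t | Z i (i.insertNth t y)}.Finite := by
        obtain ⟨c⟩ := ‹Nonempty M›
        have := hZf i (i.insertNth c y)
        simpa using this
      have : {w | ∃ t, Z i (i.insertNth t y) ∧ D (i.insertNth t y) w} =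
          ⋃ t ∈ {t | Z i (i.insertNth t y)}, {w | D (i.insertNth t y) w} := by
        ext w; simp
      rw [this]
      exact h1.biUnion (fun t _ => hfin _)
    obtain ⟨K, hK⟩ := huf (fun y w => ∃ t : M, Z i (i.insertNth t y) ∧ D (i.insertNth t y) w) autodef hfin2
    refine ⟨K, fun x hx => le_trans (ncard_le_ncard ?_ (hfin2 (i.removeNth x))) (hK (i.removeNth x))⟩
    intro w hw
    exact ⟨x i, by simpa using hx, by simpa using hw⟩
  choose K hK using hi
  refine ⟨k + ∑ i, K i, fun x => ?_⟩
  by_cases h : k ≤ {y | D x y}.ncard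
  · obtain ⟨i, hi⟩ := hk x h
    have := Finset.single_le_sum (f := K) (fun _ _ => Nat.zero_le _) (Finset.mem_univ i)
    have := hK i x hi
    omega
  · omega

/-- cells of the complement of a finite set -/
def Cell (B : M → Prop) (j : ℕ) (a : M) : Prop := ¬ B a ∧ {b | B b ∧ b < a}.ncard = j

theorem cell_conv {B : M → Prop} (hB : {b | B b}.Finite) {j : ℕ} {a a' z : M} (ha : Cell B j a) (ha' : Cell B j a')
    (h1 : a ≤ z) (h2 : z ≤ a') : ¬ B z := by
  intro hz
  have hza : a < z := lt_of_le_of_ne h1 (fun h => ha.1 (h ▸ hz))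
  have hza' : z < a' := lt_of_le_of_ne h2 (fun h => ha'.1 (h ▸ hz))
  have : {b | B b ∧ b < a} ⊂ {b | B b ∧ b < a'} := by
    refine ssubset_iff_subset_ne.2 ⟨fun b hb => ⟨hb.1, hb.2.trans (hza.trans hza')⟩, fun h => ?_⟩
    have : z ∈ {b | B b ∧ b < a} := h ▸ (⟨hz, hza'⟩ : z ∈ {b | B b ∧ b < a'})
    exact lt_asymm hza this.2
  have := ncard_lt_ncard this (hB.subset fun b hb => hb.1)
  rw [ha.2, ha'.2] at this
  exact lt_irrefl _ this

theorem cell_conv' {B : M → Prop} (hB : {b | B b}.Finite) {j : ℕ} {a a' z : M} (ha : Cell B j a) (ha' : Cell B j a')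
    (h1 : a ≤ z) (h2 : z ≤ a') : Cell B j z := by
  refine ⟨cell_conv hB ha ha' h1 h2, ?_⟩
  rw [← ha.2]
  congr 1
  ext b
  refine ⟨fun h => ⟨h.1, ?_⟩, fun h => ⟨h.1, h.2.trans_le h1⟩⟩
  by_contra hn
  exact cell_conv hB ha ha' (not_lt.1 hn) (h.2.le.trans h2) h.1

theorem cell_open {B : M → Prop} (hB : {b | B b}.Finite) {j : ℕ} {a : M} (ha : Cell B j a) :
    ∀ᶠ z in 𝓝 a, Cell B j z := by
  have : ∀ᶠ z in 𝓝 a, ∀ b ∈ {b | B b}, (b < z ↔ b < a) ∧ z ≠ b := by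
    rw [Filter.eventually_all_finite hB]
    intro b hb
    rcases lt_trichotomy b a with h | h | h
    · filter_upwards [Ioi_mem_nhds h] with z hz
      exact ⟨⟨fun _ => h, fun _ => hz⟩, ne_of_gt hz⟩
    · exact absurd (h ▸ hb) ha.1
    · filter_upwards [Iio_mem_nhds h] with z hz
      exact ⟨⟨fun h' => absurd h' (not_lt.2 (le_of_lt hz)), fun h' => absurd h' (not_lt.2 h.le)⟩, ne_of_lt hz⟩
  filter_upwards [this] with z hz
  refine ⟨fun h => (hz z h).2 rfl, ?_⟩
  rw [← ha.2]
  congr 1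
  ext b
  exact ⟨fun h => ⟨h.1, (hz b h.1).1.1 h.2⟩, fun h => ⟨h.1, (hz b h.1).1.2 h.2⟩⟩

theorem def_cell {B : Γ → M → Prop} (hB : Def L M (fun p : Γ × M => B p.1 p.2)) (hfin : ∀ x, {y | B x y}.Finite) (j : ℕ) :
    Def L M (fun p : Γ × M => Cell (B p.1) j p.2) := by
  have h1 : ∀ k, Def L M (fun p : Γ × M => k ≤ {b | B p.1 b ∧ b < p.2}.ncard) := fun k =>
    def_ncard (D := fun (p : Γ × M) b => B p.1 b ∧ b < p.2) autodef (fun p => (hfin p.1).subset fun b hb => hb.1) k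
  have h2 := h1 j
  have h3 := h1 (j+1)
  have : Def L M (fun p : Γ × M => ¬ B p.1 p.2 ∧ (j ≤ {b | B p.1 b ∧ b < p.2}.ncard ∧ ¬ (j+1 ≤ {b | B p.1 b ∧ b < p.2}.ncard))) :=
    Def.and autodef (h2.and h3.not)
  refine this.congr fun p => ?_
  unfold Cell
  refine and_congr Iff.rfl ?_
  omega

/-- A one-parameter family of open convex sets meets the complement of a small set stably. -/
theorem conv_family (C E : M → M → Prop) (hC : Def L M (fun p : M × M => C p.1 p.2)) (hE : Def L M (fun p : M × M => E p.1 p.2))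
    (hconv : ∀ t a a' z, C t a → C t a' → a ≤ z → z ≤ a' → C t z)
    (hopen : ∀ t a, C t a → ∀ᶠ z in 𝓝 a, C t z) (hEf : ∀ a, {t | E t a}.Finite) :
    {t0 | ¬ ((∀ᶠ t in 𝓝 t0, ∀ a, ¬ C t a) ∨ ∃ a, (∀ᶠ t in 𝓝 t0, C t a) ∧ ¬ E t0 a)}.Finite := by
  refine fin_of_dense (L := L) (Q := fun t0 => (∀ᶠ t in 𝓝 t0, ∀ a, ¬ C t a) ∨ ∃ a, (∀ᶠ t in 𝓝 t0, C t a) ∧ ¬ E t0 a) autodef ?_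
  intro p q hpq
  have dN : Def L M (fun t => ∃ a, C t a) := autodef
  obtain ⟨p1, q1, h1, h2, h3, h4⟩ := shrink dN hpq
  rcases h4 with h4 | h4
  · have a1 := lemmaA (L := L) (fun t z => ∃ a, C t a ∧ z ≤ a) autodef
      (by rintro t y y' hy ⟨w, h1, h2⟩; exact ⟨w, h1, hy.trans h2⟩)
    have a2 := lemmaA (L := L) (fun t z => ∀ a, C t a → z < a) autodef
      (by intro t y y' hy h w hw; exact hy.trans_lt (h w hw))
    obtain ⟨t0, ht0, hn⟩ := ((Ioo_infinite h2).diff (a1.union a2)).nonempty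
    simp only [mem_union, mem_setOf_eq, not_or, not_not] at hn
    obtain ⟨hn1, hn2⟩ := hn
    obtain ⟨a, ha⟩ := h4 t0 ht0.1 ht0.2
    have e1 := hn1 a (by
      filter_upwards [hopen t0 a ha] with z hz
      exact ⟨fun _ => ⟨a, ha, le_rfl⟩, fun _ => ⟨z, hz, le_rfl⟩⟩)
    have e2 := hn2 a (by
      filter_upwards [hopen t0 a ha] with z hz
      exact ⟨fun h => absurd (h z hz) (lt_irrefl _), fun h => absurd (h a ha) (lt_irrefl _)⟩)
    have e3 : ∀ᶠ t in 𝓝 t0, C t a := by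
      filter_upwards [e1, e2] with t h5 h6
      obtain ⟨b, hb1, hb2⟩ := h5.2 ⟨a, ha, le_rfl⟩
      have : ¬ ∀ b, C t b → a < b := fun h => absurd (h6.1 h a ha) (lt_irrefl _)
      push Not at this
      obtain ⟨c, hc1, hc2⟩ := this
      exact hconv t c b a hc1 hb1 hc2 hb2
    obtain ⟨p2, q2, hp2, hq2, h7⟩ := ev_nhds.1 e3
    have hlt : max p1 p2 < min q1 q2 := (max_lt ht0.1 hp2).trans (lt_min ht0.2 hq2)
    obtain ⟨t1, ht1, hE1⟩ := ((Ioo_infinite hlt).diff (hEf a)).nonempty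
    rw [mem_Ioo, max_lt_iff, lt_min_iff] at ht1
    refine ⟨t1, h1.trans_lt ht1.1.1, ht1.2.1.trans_le h3, Or.inr ⟨a, ?_, hE1⟩⟩
    exact ev_nhds.2 ⟨p2, q2, ht1.1.2, ht1.2.2, h7⟩
  · obtain ⟨t, ht1, ht2⟩ := exists_between h2
    refine ⟨t, h1.trans_lt ht1, ht2.trans_le h3, Or.inl (ev_nhds.2 ⟨p1, q1, ht1, ht2, fun y h5 h6 a ha => h4 y h5 h6 ⟨a, ha⟩⟩)⟩

theorem cons_upd {n : ℕ} (a : M) (x : Fin n → M) (i : Fin n) (t : M) :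
    (Fin.cons a (Function.update x i t) : Fin (n+1) → M) = Function.update (Fin.cons a x : Fin (n+1) → M) i.succ t := by
  rw [Fin.cons_update]

theorem tb_succ {n : ℕ} (htb : TB L M n) (huf : UF L M n) : TB L M (n+1) := by
  intro A hA hanti hex htame
  choose B hBd hBf hBc using htame
  have hB0 := hBd 0
  have hB0f : ∀ x : Fin n → M, {a | B 0 (Fin.cons a x)}.Finite := by
    intro x
    obtain ⟨c⟩ := ‹Nonempty M›
    simpa using hBf 0 (Fin.cons c x)
  obtain ⟨K, hK⟩ := huf (fun x a => B 0 (Fin.cons a x : Fin (n+1) → M)) autodef hB0f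
  have hCd : ∀ j, Def L M (fun p : (Fin n → M) × M => Cell (fun a => B 0 (Fin.cons a p.1 : Fin (n+1) → M)) j p.2) := fun j =>
    def_cell (B := fun x a => B 0 (Fin.cons a x : Fin (n+1) → M)) autodef hB0f j
  -- constancy on cells
  have hconst : ∀ j k (x : Fin n → M) a a', Cell (fun a => B 0 (Fin.cons a x : Fin (n+1) → M)) j a →
      Cell (fun a => B 0 (Fin.cons a x : Fin (n+1) → M)) j a' → (A k (Fin.cons a x) ↔ A k (Fin.cons a' x)) := by
    intro j k x
    have key : ∀ a a', a ≤ a' → Cell (fun a => B 0 (Fin.cons a x : Fin (n+1) → M)) j a →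
      Cell (fun a => B 0 (Fin.cons a x : Fin (n+1) → M)) j a' → (A k (Fin.cons a x) ↔ A k (Fin.cons a' x)) := by
      intro a a' haa ha ha'
      have hAk := hA k
      refine locconst (L := L) (P := fun a => A k (Fin.cons a x)) autodef haa ?_
      intro c hc1 hc2
      have h1 := cell_conv (hB0f x) ha ha' hc1 hc2
      simpa using hBc 0 k _ h1
    intro a a' ha ha'
    rcases le_total a a' with h | h
    · exact key a a' h ha ha'
    · exact (key a' a h ha' ha).symm
  have hj : ∀ j, ∃ Z : Fin n → (Fin n → M) → Prop, (∀ i, Def L M (Z i)) ∧ (∀ i, FinDir i (Z i)) ∧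
      ∃ k, ∀ x, (∃ a, Cell (fun a => B 0 (Fin.cons a x : Fin (n+1) → M)) j a ∧ A k (Fin.cons a x)) → ∃ i, Z i x := by
    intro j
    set C : (Fin n → M) → M → Prop := fun x a => Cell (fun a => B 0 (Fin.cons a x : Fin (n+1) → M)) j a with hCdef
    have hC : Def L M (fun p : (Fin n → M) × M => C p.1 p.2) := hCd j
    refine htb (fun k x => ∃ a, C x a ∧ A k (Fin.cons a x)) (fun k => ?_) ?_ ?_ ?_
    · have := hA k
      exact autodef
    · rintro k k' x hk ⟨a, ha1, ha2⟩
      exact ⟨a, ha1, hanti _ _ _ hk ha2⟩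
    · intro x
      by_cases h : ∃ a, C x a
      · obtain ⟨a, ha⟩ := h
        obtain ⟨k, hk⟩ := hex (Fin.cons a x)
        refine ⟨k, ?_⟩
        rintro ⟨a', h1, h2⟩
        exact hk ((hconst j k x a a' ha h1).2 h2)
      · exact ⟨0, fun ⟨a, h1, _⟩ => h ⟨a, h1⟩⟩
    · intro i
      have hBi := hBd i.succ
      refine ⟨fun x => ¬ ((∀ᶠ t in 𝓝 (x i), ∀ a, ¬ C (Function.update x i t) a) ∨
        ∃ a, (∀ᶠ t in 𝓝 (x i), C (Function.update x i t) a) ∧ ¬ B i.succ (Fin.cons a x)), autodef, ?_, ?_⟩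
      · intro x
        have := conv_family (L := L) (fun t a => C (Function.update x i t) a)
          (fun t a => B i.succ (Fin.cons a (Function.update x i t))) autodef autodef
          (fun t a a' z h1 h2 h3 h4 => cell_conv' (hB0f _) h1 h2 h3 h4)
          (fun t a h => cell_open (hB0f _) h)
          (fun a => by
            simp only [cons_upd]
            exact hBf i.succ _)
        simpa only [Function.update_idem, Function.update_self] using this
      · intro k x hx
        rw [not_not] at hx
        rcases hx with hx | ⟨a, ha1, ha2⟩
        · have h0 := hx.self_of_nhds
          rw [Function.update_eq_self] at h0
          filter_upwards [hx] with t ht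
          exact ⟨fun ⟨a, h1, _⟩ => absurd h1 (ht a), fun ⟨a, h1, _⟩ => absurd h1 (h0 a)⟩
        · have h0 := ha1.self_of_nhds
          rw [Function.update_eq_self] at h0
          have h1 := hBc i.succ k _ ha2
          rw [Fin.cons_succ] at h1
          have key : ∀ x, C x a → ((∃ a, C x a ∧ A k (Fin.cons a x)) ↔ A k (Fin.cons a x)) := fun x hx =>
            ⟨fun ⟨a', h3, h4⟩ => (hconst j k x a a' hx h3).2 h4, fun h => ⟨a, hx, h⟩⟩
          filter_upwards [ha1, h1] with t ht ht1
          rw [key _ ht, key _ h0, cons_upd]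
          exact ht1
  choose Z hZd hZf k hk using hj
  refine ⟨Fin.cases (B 0) (fun i w => ∃ j : Fin (K+1), Z j i (Fin.tail w)), ?_, ?_, ∑ j : Fin (K+1), k j, ?_⟩
  · intro i
    refine Fin.cases hB0 (fun i => ?_) i
    refine Def.fex fun j => ?_
    have := hZd j i
    exact autodef
  · intro i
    refine Fin.cases (hBf 0) (fun i => ?_) i
    intro w
    have : {t | ∃ j : Fin (K+1), Z j i (Fin.tail (Function.update w i.succ t))} =
        ⋃ j : Fin (K+1), {t | Z j i (Function.update (Fin.tail w) i t)} := by
      ext t; simp [Fin.tail_update_succ]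
    show {t | ∃ j : Fin (K+1), Z j i (Fin.tail (Function.update w i.succ t))}.Finite
    rw [this]
    exact finite_iUnion fun j => hZf j i _
  · intro w hw
    by_cases hB : B 0 w
    · exact ⟨0, hB⟩
    · have hfw := hB0f (Fin.tail w)
      set j := {b | B 0 (Fin.cons b (Fin.tail w) : Fin (n+1) → M) ∧ b < w 0}.ncard with hjdef
      have hjK : j ≤ K := (ncard_le_ncard (fun b hb => hb.1) hfw).trans (hK (Fin.tail w))
      have hkj : k j ≤ ∑ j : Fin (K+1), k j :=
        Finset.single_le_sum (f := fun j : Fin (K+1) => k j) (fun _ _ => Nat.zero_le _) (Finset.mem_univ (⟨j, by omega⟩ : Fin (K+1)))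
      obtain ⟨i, hi⟩ := hk j (Fin.tail w) ⟨w 0, ⟨by simpa using hB, hjdef.symm⟩, by
        simpa using hanti _ _ _ hkj hw⟩
      exact ⟨i.succ, ⟨j, by omega⟩, hi⟩

theorem tb_uf (n : ℕ) : TB L M n ∧ UF L M n := by
  induction n with
  | zero => exact ⟨tb_zero, uf_zero⟩
  | succ n ih =>
    have := tb_succ ih.1 ih.2
    exact ⟨this, uf_of_tb this ih.2⟩

/-- Uniform finiteness. -/
theorem unif_fin (D : Γ → M → Prop) (hD : Def L M (fun p : Γ × M => D p.1 p.2)) (hfin : ∀ x, {y | D x y}.Finite) :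
    ∃ K, ∀ x, {y | D x y}.ncard ≤ K := by
  obtain ⟨n, ⟨f⟩⟩ := Finite.exists_equiv_fin (DSpace.ι M Γ)
  let e : (Fin n → M) ≃ Γ := (Equiv.arrowCongr f.symm (Equiv.refl M)).trans (DSpace.e (M := M)).symm
  have he : DMap L M (fun v : Fin n → M => e v) := by
    refine dmap_of_ren _ (fun i => f i) ?_
    intro v i
    simp [e]
    rfl
  obtain ⟨K, hK⟩ := (tb_uf (L := L) n).2 (fun v y => D (e v) y) autodef (fun v => hfin _)
  refine ⟨K, fun x => ?_⟩
  have := hK (e.symm x)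
  simpa using this

end
end OMinAux

open FirstOrder Set
namespace OMinAux
open Filter Topology
section
variable {L : FirstOrder.Language} {M : Type u} [L.Structure M] [LinearOrder M] [OM L M]
variable {Γ Δ Θ Λ : Type u} [DSpace M Γ] [DSpace M Δ] [DSpace M Θ] [DSpace M Λ]

/-- `y ∈ D` and there are at least `k` alternations of `D` below `y` -/
def Alt (D : M → Prop) : ℕ → M → Prop
  | 0, y => D y
  | k+1, y => D y ∧ ∃ z, z < y ∧ ¬ D z ∧ ∃ y', y' < z ∧ Alt D k y'

/-- the `k`-th convex component of `D` -/
def Cmp (D : M → Prop) (k : ℕ) (y : M) : Prop := Alt D k y ∧ ¬ Alt D (k+1) y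

theorem Alt.mem {D : M → Prop} {k : ℕ} {y : M} (h : Alt D k y) : D y := by
  cases k with
  | zero => exact h
  | succ k => exact h.1

theorem Alt.pred {D : M → Prop} {k : ℕ} : ∀ {y : M}, Alt D (k+1) y → Alt D k y := by
  induction k with
  | zero => intro y h; exact h.1
  | succ k ih =>
    rintro y ⟨h1, z, h2, h3, y', h4, h5⟩
    exact ⟨h1, z, h2, h3, y', h4, ih h5⟩

theorem Alt.anti {D : M → Prop} {k j : ℕ} {y : M} (h : k ≤ j) : Alt D j y → Alt D k y := by
  induction h with
  | refl => exact id
  | step h ih => exact fun h' => ih h'.pred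

theorem Alt.mono {D : M → Prop} {k : ℕ} {y y' : M} (h : Alt D k y) (hy : y ≤ y') (hD : D y') : Alt D k y' := by
  cases k with
  | zero => exact hD
  | succ k =>
    obtain ⟨h1, z, h2, h3, y1, h4, h5⟩ := h
    exact ⟨hD, z, h2.trans_le hy, h3, y1, h4, h5⟩

theorem Alt.conv {D : M → Prop} {k : ℕ} {y y' : M} (h : Alt D k y') (hy : y ≤ y') (hD : ∀ z, y ≤ z → z ≤ y' → D z) :
    Alt D k y := by
  cases k with
  | zero => exact hD y le_rfl hy
  | succ k =>
    obtain ⟨h1, z, h2, h3, y1, h4, h5⟩ := h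
    exact ⟨hD y le_rfl hy, z, lt_of_not_ge fun h => h3 (hD z h h2.le), h3, y1, h4, h5⟩

theorem Cmp.mem {D : M → Prop} {k : ℕ} {y : M} (h : Cmp D k y) : D y := h.1.mem

theorem Cmp.conv {D : M → Prop} {k : ℕ} {y y' z : M} (h : Cmp D k y) (h' : Cmp D k y') (h1 : y ≤ z) (h2 : z ≤ y') :
    Cmp D k z := by
  have hz : D z := by
    by_contra hz
    have e1 : y < z := lt_of_le_of_ne h1 (fun e => hz (e ▸ h.mem))
    have e2 : z < y' := lt_of_le_of_ne h2 (fun e => hz (e ▸ h'.mem))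
    exact h'.2 ⟨h'.mem, z, e2, hz, y, e1, h.1⟩
  exact ⟨h.1.mono h1 hz, fun h3 => h'.2 (h3.mono h2 h'.mem)⟩

theorem Cmp.lt {D : M → Prop} {k j : ℕ} {y y' : M} (h : Cmp D k y) (h' : Cmp D j y') (hkj : k < j) : y < y' := by
  by_contra hn
  exact h.2 ((h'.1.anti hkj).mono (not_lt.1 hn) h.mem)

theorem Cmp.uniq {D : M → Prop} {k j : ℕ} {y : M} (h : Cmp D k y) (h' : Cmp D j y) : k = j := by
  rcases lt_trichotomy k j with e | e | e
  · exact absurd (h.lt h' e) (lt_irrefl _)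
  · exact e
  · exact absurd (h'.lt h e) (lt_irrefl _)

/-- moving inside a connected part of `D` stays in the component -/
theorem Cmp.move {D : M → Prop} {k : ℕ} {y y' : M} (h : Cmp D k y) (hD : ∀ z, min y y' ≤ z → z ≤ max y y' → D z) :
    Cmp D k y' := by
  rcases le_total y y' with e | e
  · rw [min_eq_left e, max_eq_right e] at hD
    exact ⟨h.1.mono e (hD _ e le_rfl), fun h' => h.2 (h'.conv e hD)⟩
  · rw [min_eq_right e, max_eq_left e] at hD
    exact ⟨h.1.conv e hD, fun h' => h.2 (h'.mono e h.mem)⟩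

theorem exists_cmp {D : M → Prop} {N : ℕ} (hN : ∀ y, ¬ Alt D N y) {y : M} (hy : D y) : ∃ k : Fin N, Cmp D k y := by
  classical
  have hex : ∃ k, ¬ Alt D k y := ⟨N, hN y⟩
  have h1 := Nat.find_spec hex
  have h0 : Nat.find hex ≠ 0 := by
    intro h; rw [h] at h1; exact h1 hy
  obtain ⟨k, hk⟩ := Nat.exists_eq_succ_of_ne_zero h0
  have h2 := Nat.find_min hex (m := k) (by omega)
  have h3 : Nat.find hex ≤ N := Nat.find_le (hN y)
  rw [hk] at h1
  exact ⟨⟨k, by omega⟩, not_not.1 h2, h1⟩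

theorem def_alt {D : Γ → M → Prop} (hD : Def L M (fun p : Γ × M => D p.1 p.2)) (k : ℕ) :
    Def L M (fun p : Γ × M => Alt (D p.1) k p.2) := by
  induction k with
  | zero => exact hD
  | succ k ih =>
    show Def L M (fun p : Γ × M => D p.1 p.2 ∧ ∃ z, z < p.2 ∧ ¬ D p.1 z ∧ ∃ y', y' < z ∧ Alt (D p.1) k y')
    have ih' : Def L M (fun p : Γ × M => (fun g => Alt (D g) k) p.1 p.2) := ih
    generalize (fun g => Alt (D g) k) = A at ih'
    have : ∀ g, Alt (D g) k = Alt (D g) k := fun _ => rfl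
    exact Def.and hD (Def.ex (Def.and autodef (Def.and autodef (Def.ex (Def.and autodef
      (Def.comp2 (P := fun g y => Alt (D g) k y) ih autodef autodef))))))

theorem def_cmp {D : Γ → M → Prop} (hD : Def L M (fun p : Γ × M => D p.1 p.2)) (k : ℕ) :
    Def L M (fun p : Γ × M => Cmp (D p.1) k p.2) := (def_alt hD k).and (def_alt hD (k+1)).not

variable [TopologicalSpace M] [OrderTopology M] [DenselyOrdered M] [NoMinOrder M] [NoMaxOrder M] [Nonempty M]

theorem alt_card {D : M → Prop} (hD : Def L M D) {k : ℕ} : ∀ {y : M}, Alt D k y →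
    k ≤ {b | (¬ ∀ᶠ z in 𝓝 b, (D z ↔ D b)) ∧ b ≤ y}.ncard := by
  induction k with
  | zero => intro y _; exact Nat.zero_le _
  | succ k ih =>
    rintro y ⟨h1, z, h2, h3, y', h4, h5⟩
    have hb : ∃ b, z ≤ b ∧ b ≤ y ∧ ¬ ∀ᶠ w in 𝓝 b, (D w ↔ D b) := by
      by_contra hn
      push Not at hn
      exact h3 ((locconst hD h2.le (fun c hc1 hc2 => hn c hc1 hc2)).2 h1)
    obtain ⟨b, hb1, hb2, hb3⟩ := hb
    have hfin : {b | (¬ ∀ᶠ z in 𝓝 b, (D z ↔ D b)) ∧ b ≤ y}.Finite := (bdry_finite hD).subset fun b hb => hb.1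
    have : {b | (¬ ∀ᶠ z in 𝓝 b, (D z ↔ D b)) ∧ b ≤ y'} ⊂ {b | (¬ ∀ᶠ z in 𝓝 b, (D z ↔ D b)) ∧ b ≤ y} := by
      refine (ssubset_iff_of_subset (fun w hw => ?_)).2 ⟨b, ⟨hb3, hb2⟩, fun h => ?_⟩
      · exact And.intro hw.1 (hw.2.trans (h4.trans h2).le)
      · exact absurd h.2 (not_le.2 (h4.trans_le hb1))
    have := ncard_lt_ncard this hfin
    have := ih h5
    omega

theorem unif_alt {D : Γ → M → Prop} (hD : Def L M (fun p : Γ × M => D p.1 p.2)) : ∃ N, ∀ x y, ¬ Alt (D x) N y := by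
  have hDx : ∀ x, Def L M (D x) := fun x => autodef
  obtain ⟨K, hK⟩ := unif_fin (L := L) (fun x b => ¬ ∀ᶠ z in 𝓝 b, (D x z ↔ D x b)) autodef (fun x => bdry_finite (hDx x))
  refine ⟨K+1, fun x y h => ?_⟩
  have h1 := alt_card (hDx x) h
  have h2 := ncard_le_ncard (s := {b | (¬ ∀ᶠ z in 𝓝 b, (D x z ↔ D x b)) ∧ b ≤ y})
    (t := {b | ¬ ∀ᶠ z in 𝓝 b, (D x z ↔ D x b)}) (fun b hb => hb.1) (bdry_finite (hDx x))
  have := hK x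
  omega

theorem exists_consts (N : ℕ) : ∃ c : Fin N → M, Function.Injective c := by
  haveI : Infinite M := by
    haveI : Nontrivial M := by
      obtain ⟨a⟩ := ‹Nonempty M›
      obtain ⟨b, hb⟩ := exists_gt a
      exact ⟨a, b, hb.ne⟩
    exact Set.infinite_univ_iff.1 (Set.infinite_of_forall_exists_gt (fun a => (exists_gt a).imp fun b h => ⟨trivial, h⟩))
  exact ⟨_, (Fin.valEmbedding.trans (Infinite.natEmbedding M)).injective⟩

end
end OMinAux

open FirstOrder Set
namespace OMinAux
open Filter Topology
section
variable {L : FirstOrder.Language} {M : Type u} [L.Structure M] [LinearOrder M] [OM L M]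
variable {Γ Δ Θ Λ : Type u} [DSpace M Γ] [DSpace M Δ] [DSpace M Θ] [DSpace M Λ]

variable (L M) in
/-- definable types, as predicates -/
structure IsT (n : ℕ) (p : ((Fin n → M) → Prop) → Prop) : Prop where
  dfn : ∀ X, p X → Def L M X
  bot : ¬ p (fun _ => False)
  and : ∀ X Y, p X → p Y → p (fun x => X x ∧ Y x)
  up : ∀ X Y, p X → Def L M Y → (∀ x, X x → Y x) → p Y
  em : ∀ X, Def L M X → p X ∨ p (fun x => ¬ X x)
  param : ∀ (Δ : Type u) [DSpace M Δ] (X : Δ → (Fin n → M) → Prop), Def L M (fun q : Δ × (Fin n → M) => X q.1 q.2) →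
    Def L M (fun δ => p (X δ))

theorem IsT.top {n : ℕ} {p : ((Fin n → M) → Prop) → Prop} (h : IsT L M n p) {X : (Fin n → M) → Prop} (hX : ∀ x, X x) : p X := by
  have hd : Def L M X := (Def.cst True).congr (fun x => by simp [hX x])
  rcases h.em _ hd with h1 | h1
  · exact h1
  · exact absurd (h.up _ (fun _ => False) h1 (Def.cst _) (fun x hx => hx (hX x))) h.bot

theorem IsT.nonempty {n : ℕ} {p : ((Fin n → M) → Prop) → Prop} (h : IsT L M n p) {X : (Fin n → M) → Prop} (hX : p X) :
    ∃ x, X x := by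
  by_contra hn
  push Not at hn
  exact h.bot (h.up _ _ hX (Def.cst _) (fun x hx => hn x hx))

theorem IsT.or {n : ℕ} {p : ((Fin n → M) → Prop) → Prop} (h : IsT L M n p) {X Y Z : (Fin n → M) → Prop}
    (hX : Def L M X) (hY : Def L M Y) (hZ : p Z) (hZXY : ∀ z, Z z → X z ∨ Y z) : p X ∨ p Y := by
  rcases h.em _ hX with h1 | h1
  · exact Or.inl h1
  · refine Or.inr (h.up _ _ (h.and _ _ hZ h1) hY ?_)
    rintro x ⟨h2, h3⟩
    exact (hZXY x h2).resolve_left h3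

theorem IsT.fex {n N : ℕ} {p : ((Fin n → M) → Prop) → Prop} (h : IsT L M n p) {Z : (Fin n → M) → Prop} {X : Fin N → (Fin n → M) → Prop}
    (hX : ∀ k, Def L M (X k)) (hZ : p Z) (hZX : ∀ z, Z z → ∃ k, X k z) : ∃ k, p (X k) := by
  induction N generalizing Z with
  | zero =>
    obtain ⟨x, hx⟩ := h.nonempty hZ
    exact (hZX x hx).choose.elim0
  | succ N ih =>
    rcases h.em _ (hX 0) with h0 | h0
    · exact ⟨0, h0⟩
    · obtain ⟨k, hk⟩ := ih (X := fun k => X k.succ) (fun k => hX _) (h.and _ _ hZ h0) (by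
        rintro x ⟨h2, h3⟩
        obtain ⟨k, hk⟩ := hZX x h2
        revert hk
        refine Fin.cases (fun hk => absurd hk h3) (fun k hk => ⟨k, hk⟩) k)
      exact ⟨k.succ, hk⟩

theorem IsT.proj {n : ℕ} {p : ((Fin (n+1) → M) → Prop) → Prop} [Nonempty M] (h : IsT L M (n+1) p) :
    IsT L M n (fun Y => p (fun w => Y (Fin.tail w))) where
  dfn X hX := by
    obtain ⟨c⟩ := ‹Nonempty M›
    have := h.dfn _ hX
    have h2 : Def L M (fun x : Fin n → M => X (Fin.tail (Fin.cons c x : Fin (n+1) → M))) :=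
      Def.comp (P := fun w : Fin (n+1) → M => X (Fin.tail w)) this autodef
    simpa using h2
  bot := h.bot
  and X Y hX hY := h.and _ _ hX hY
  up X Y hX hY hXY := h.up _ _ hX autodef (fun x hx => hXY _ hx)
  em X hX := h.em _ autodef
  param Δ _ X hX := h.param Δ (fun δ w => X δ (Fin.tail w)) autodef

variable [TopologicalSpace M] [OrderTopology M] [DenselyOrdered M] [NoMinOrder M] [NoMaxOrder M] [Nonempty M]

theorem step_a (n : ℕ) : ∀ (p : ((Fin n → M) → Prop) → Prop), IsT L M n p → ∀ (Δ : Type u) [DSpace M Δ]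
    (X : Δ → (Fin n → M) → Prop), Def L M (fun q : Δ × (Fin n → M) => X q.1 q.2) → (∃ δ, p (X δ)) →
    ∃ (Θ : Type u) (_ : DSpace M Θ) (W : Θ → Prop) (G : Θ → (Fin n → M) → Prop), Def L M W ∧
      Def L M (fun q : Θ × (Fin n → M) => G q.1 q.2) ∧ (∀ θ, W θ → p (G θ)) ∧
      (∀ θ θ', W θ → W θ' → ∃ θ'', W θ'' ∧ ∀ x, G θ'' x → G θ x ∧ G θ' x) ∧
      (∀ δ, p (X δ) → ∃ θ, W θ ∧ ∀ x, G θ x → X δ x) := by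
  induction n with
  | zero =>
    intro p hp Δ _ X hX _
    refine ⟨Fin 0 → M, inferInstance, fun _ => True, fun _ _ => True, Def.cst _, Def.cst _, fun _ _ => hp.top (fun _ => trivial),
      fun θ _ _ _ => ⟨θ, trivial, fun _ _ => ⟨trivial, trivial⟩⟩, fun δ hδ => ⟨fun i => i.elim0, trivial, fun x _ => ?_⟩⟩
    obtain ⟨y, hy⟩ := hp.nonempty hδ
    rwa [Subsingleton.elim x y]
  | succ n ih =>
    intro p hp Δ _ X hX hne
    have hq := hp.proj
    set q : ((Fin n → M) → Prop) → Prop := fun Y => p (fun w => Y (Fin.tail w)) with hqdef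
    have hX2 : Def L M (fun r : (Δ × (Fin n → M)) × M => X r.1.1 (Fin.cons r.2 r.1.2)) := autodef
    obtain ⟨N, hN⟩ := unif_alt (L := L) (D := fun (r : Δ × (Fin n → M)) y => X r.1 (Fin.cons y r.2)) hX2
    obtain ⟨c, hc⟩ := exists_consts (M := M) N
    have hcmp : ∀ k : Fin N, Def L M (fun r : (Δ × (Fin n → M)) × M => Cmp (fun y => X r.1.1 (Fin.cons y r.1.2)) k r.2) :=
      fun k => def_cmp (D := fun (r : Δ × (Fin n → M)) y => X r.1 (Fin.cons y r.2)) hX2 k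
    obtain ⟨C, hCdef⟩ : ∃ C : (Δ × M) → (Fin n → M) → M → Prop, C = fun t x y =>
      ∃ k : Fin N, t.2 = c k ∧ Cmp (fun y => X t.1 (Fin.cons y x)) k y := ⟨_, rfl⟩
    have hC : Def L M (fun r : (Δ × M) × (Fin n → M) × M => C r.1 r.2.1 r.2.2) := by
      rw [hCdef]
      refine Def.fex fun k => Def.and autodef ?_
      exact Def.comp2 (P := fun (r : Δ × (Fin n → M)) y => Cmp (fun y => X r.1 (Fin.cons y r.2)) k y)
        (f := fun r : (Δ × M) × (Fin n → M) × M => (r.1.1, r.2.1)) (g := fun r => r.2.2) (hcmp k) autodef autodef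
    have hCconv : ∀ t x y y' z, C t x y → C t x y' → y ≤ z → z ≤ y' → C t x z := by
      rw [hCdef]
      rintro t x y y' z ⟨k, hk, h1⟩ ⟨k', hk', h2⟩ h3 h4
      have : k = k' := hc (hk.symm.trans hk')
      subst this
      exact ⟨k, hk, h1.conv h2 h3 h4⟩
    have hCX : ∀ t w, C t (Fin.tail w) (w 0) → X t.1 w := by
      rw [hCdef]
      rintro t w ⟨k, hk, h1⟩
      simpa using h1.mem
    have hCcov : ∀ δ, p (X δ) → ∃ t : Δ × M, t.1 = δ ∧ p (fun w => C t (Fin.tail w) (w 0)) := by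
      intro δ hδ
      obtain ⟨k, hk⟩ := hp.fex (X := fun (k : Fin N) w => C (δ, c k) (Fin.tail w) (w 0)) (fun k => autodef) hδ (by
        intro w hw
        obtain ⟨k, hk⟩ := exists_cmp (D := fun y => X δ (Fin.cons y (Fin.tail w))) (fun y => hN (δ, Fin.tail w) y) (y := w 0)
          (by simpa using hw)
        rw [hCdef]
        exact ⟨k, k, rfl, hk⟩)
      exact ⟨(δ, c k), rfl, hk⟩
    have hqp : ∀ Y, q Y → p (fun w => Y (Fin.tail w)) := fun Y h => h
    clear_value q
    clear hCdef hcmp hN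
    let U : (Δ × M) → (Fin n → M) → M → Prop := fun t x y => ∃ y', C t x y' ∧ y' ≤ y
    let V : (Δ × M) → (Fin n → M) → M → Prop := fun t x y => ∃ y', C t x y' ∧ y ≤ y'
    let Om : (Δ × M) → Prop := fun t => p (fun w => C t (Fin.tail w) (w 0))
    have hOm : Def L M Om := hp.param _ (fun t w => C t (Fin.tail w) (w 0)) autodef
    have hU : Def L M (fun r : (Δ × M) × (Fin n → M) × M => U r.1 r.2.1 r.2.2) := by
      show Def L M (fun r : (Δ × M) × (Fin n → M) × M => ∃ y', C r.1 r.2.1 y' ∧ y' ≤ r.2.2)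
      exact autodef
    have hV : Def L M (fun r : (Δ × M) × (Fin n → M) × M => V r.1 r.2.1 r.2.2) := by
      show Def L M (fun r : (Δ × M) × (Fin n → M) × M => ∃ y', C r.1 r.2.1 y' ∧ r.2.2 ≤ y')
      exact autodef
    have hUU : ∀ t t' x, (∀ y, U t x y → U t' x y) ∨ (∀ y, U t' x y → U t x y) := by
      intro t t' x
      by_contra hn
      push Not at hn
      obtain ⟨⟨y, ⟨a, h1, h2⟩, h3⟩, y', ⟨a', h1', h2'⟩, h3'⟩ := hn
      rcases le_total a a' with e | e
      · exact h3' ⟨a, h1, e.trans h2'⟩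
      · exact h3 ⟨a', h1', e.trans h2⟩
    have hVV : ∀ t t' x, (∀ y, V t x y → V t' x y) ∨ (∀ y, V t' x y → V t x y) := by
      intro t t' x
      by_contra hn
      push Not at hn
      obtain ⟨⟨y, ⟨a, h1, h2⟩, h3⟩, y', ⟨a', h1', h2'⟩, h3'⟩ := hn
      rcases le_total a a' with e | e
      · exact h3 ⟨a', h1', h2.trans e⟩
      · exact h3' ⟨a, h1, h2'.trans e⟩
    have hUC : ∀ t x y, C t x y → U t x y := fun t x y h => ⟨y, h, le_rfl⟩
    have hVC : ∀ t x y, C t x y → V t x y := fun t x y h => ⟨y, h, le_rfl⟩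
    have hUVC : ∀ t x y, U t x y → V t x y → C t x y := by
      rintro t x y ⟨a, h1, h2⟩ ⟨b, h3, h4⟩
      exact hCconv t x a b y h1 h3 h2 h4
    have hOmp : ∀ t, Om t ↔ p (fun w => C t (Fin.tail w) (w 0)) := fun t => Iff.rfl
    clear_value U V Om
    have hmU : ∀ t t', Om t → Om t' → ∃ s, Om s ∧ q (fun x => ∀ y, U s x y → U t x y) ∧ q (fun x => ∀ y, U s x y → U t' x y) := by
      intro t t' h h'
      rcases hq.or (X := fun x => ∀ y, U t x y → U t' x y) (Y := fun x => ∀ y, U t' x y → U t x y) (Z := fun _ => True)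
        autodef autodef (hq.top fun _ => trivial) (fun x _ => hUU t t' x) with e | e
      · exact ⟨t, h, hq.top fun _ _ => id, e⟩
      · exact ⟨t', h', e, hq.top fun _ _ => id⟩
    have hmV : ∀ t t', Om t → Om t' → ∃ s, Om s ∧ q (fun x => ∀ y, V s x y → V t x y) ∧ q (fun x => ∀ y, V s x y → V t' x y) := by
      intro t t' h h'
      rcases hq.or (X := fun x => ∀ y, V t x y → V t' x y) (Y := fun x => ∀ y, V t' x y → V t x y) (Z := fun _ => True)
        autodef autodef (hq.top fun _ => trivial) (fun x _ => hVV t t' x) with e | e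
      · exact ⟨t, h, hq.top fun _ _ => id, e⟩
      · exact ⟨t', h', e, hq.top fun _ _ => id⟩
    obtain ⟨δ0, hδ0⟩ := hne
    obtain ⟨t0, -, ht0⟩ := hCcov δ0 hδ0
    obtain ⟨Θ, _, W, G, hW, hG, hGq, hGd, hGf⟩ := ih q hq (((Δ × M) × (Δ × M)) × ((Δ × M) × (Δ × M)))
      (fun r x => (∀ y, U r.1.1 x y → U r.1.2 x y) ∧ (∀ y, V r.2.1 x y → V r.2.2 x y)) autodef
      ⟨((t0, t0), (t0, t0)), hq.top fun _ => ⟨fun _ => id, fun _ => id⟩⟩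
    obtain ⟨θ0, hθ0, -⟩ := hGf ((t0, t0), (t0, t0)) (hq.top fun _ => ⟨fun _ => id, fun _ => id⟩)
    refine ⟨Θ × (Δ × M) × (Δ × M), inferInstance, fun r => W r.1 ∧ Om r.2.1 ∧ Om r.2.2,
      fun r w => G r.1 (Fin.tail w) ∧ U r.2.1 (Fin.tail w) (w 0) ∧ V r.2.2 (Fin.tail w) (w 0), autodef, autodef, ?_, ?_, ?_⟩
    · rintro ⟨θ, t, s⟩ ⟨h1, h2, h3⟩
      refine hp.and _ _ (hqp _ (hGq θ h1)) (hp.and _ _ ?_ ?_)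
      · exact hp.up _ _ ((hOmp t).1 h2) autodef (fun w hw => hUC _ _ _ hw)
      · exact hp.up _ _ ((hOmp s).1 h3) autodef (fun w hw => hVC _ _ _ hw)
    · rintro ⟨θ, t, s⟩ ⟨θ', t', s'⟩ ⟨h1, h2, h3⟩ ⟨h1', h2', h3'⟩
      obtain ⟨t1, ht1, e1, e2⟩ := hmU t t' h2 h2'
      obtain ⟨s1, hs1, e3, e4⟩ := hmV s s' h3 h3'
      obtain ⟨θ1, k1, k2⟩ := hGf ((t1, t), (s1, s)) (hq.and _ _ e1 e3)
      obtain ⟨θ2, k3, k4⟩ := hGf ((t1, t'), (s1, s')) (hq.and _ _ e2 e4)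
      obtain ⟨θ3, k5, k6⟩ := hGd θ θ' h1 h1'
      obtain ⟨θ4, k7, k8⟩ := hGd θ1 θ2 k1 k3
      obtain ⟨θ5, k9, k10⟩ := hGd θ3 θ4 k5 k7
      refine ⟨(θ5, t1, s1), ⟨k9, ht1, hs1⟩, ?_⟩
      rintro w ⟨m1, m2, m3⟩
      obtain ⟨m4, m5⟩ := k10 _ m1
      obtain ⟨m6, m7⟩ := k6 _ m4
      obtain ⟨m8, m9⟩ := k8 _ m5
      exact ⟨⟨m6, (k2 _ m8).1 _ m2, (k2 _ m8).2 _ m3⟩, ⟨m7, (k4 _ m9).1 _ m2, (k4 _ m9).2 _ m3⟩⟩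
    · intro δ hδ
      obtain ⟨t, rfl, ht⟩ := hCcov δ hδ
      refine ⟨(θ0, t, t), ⟨hθ0, (hOmp t).2 ht, (hOmp t).2 ht⟩, ?_⟩
      rintro w ⟨-, h1, h2⟩
      exact hCX t w (hUVC _ _ _ h1 h2)

end
end OMinAux

open FirstOrder Set
namespace OMinAux
open Filter Topology
section
variable {L : FirstOrder.Language} {M : Type u} [L.Structure M] [LinearOrder M] [OM L M]
variable {Γ Δ Θ Λ : Type u} [DSpace M Γ] [DSpace M Δ] [DSpace M Θ] [DSpace M Λ]

theorem first_ex {D : M → Prop} {N : ℕ} (hN : ∀ y, ¬ Alt D N y) (h : ∃ y, D y) : ∃ y, Cmp D 0 y := by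
  by_contra hn
  have h1 : ∀ y, D y → Alt D 1 y := by
    intro y hy
    by_contra h2
    exact hn ⟨y, hy, h2⟩
  have h2 : ∀ k y, D y → Alt D k y := by
    intro k
    induction k with
    | zero => exact fun y hy => hy
    | succ k ih =>
      intro y hy
      obtain ⟨_, z, e1, e2, y', e3, e4⟩ := h1 y hy
      exact ⟨hy, z, e1, e2, y', e3, ih y' e4⟩
  obtain ⟨y, hy⟩ := h
  exact hN y (h2 N y hy)

/-- a nonempty convex subset of `D` which meets a component of `D` is contained in it -/
theorem Cmp.conv_sub {D C : M → Prop} (hCD : ∀ y, C y → D y) (hC : ∀ y y' z, C y → C y' → y ≤ z → z ≤ y' → C z)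
    {k : ℕ} {y y' : M} (hy : C y) (hk : Cmp D k y) (hy' : C y') : Cmp D k y' := by
  refine hk.move fun z h1 h2 => hCD z ?_
  rcases le_total y y' with e | e
  · rw [min_eq_left e] at h1; rw [max_eq_right e] at h2
    exact hC _ _ _ hy hy' h1 h2
  · rw [min_eq_right e] at h1; rw [max_eq_left e] at h2
    exact hC _ _ _ hy' hy h1 h2

variable (L M) in
structure DFam (n : ℕ) {Δ : Type u} [DSpace M Δ] (W : Δ → Prop) (S : Δ → (Fin n → M) → Prop) : Prop where
  dW : Def L M W
  dS : Def L M (fun q : Δ × (Fin n → M) => S q.1 q.2)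
  ex : ∃ δ, W δ
  ne : ∀ δ, W δ → ∃ x, S δ x
  dir : ∀ δ δ', W δ → W δ' → ∃ δ'', W δ'' ∧ ∀ x, S δ'' x → S δ x ∧ S δ' x

theorem DFam.fin {n : ℕ} {W : Δ → Prop} {S : Δ → (Fin n → M) → Prop} (h : DFam L M n W S) {N : ℕ} (f : Fin N → Δ)
    (hf : ∀ k, W (f k)) : ∃ δ, W δ ∧ ∀ k x, S δ x → S (f k) x := by
  induction N with
  | zero =>
    obtain ⟨δ, hδ⟩ := h.ex
    exact ⟨δ, hδ, fun k => k.elim0⟩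
  | succ N ih =>
    obtain ⟨δ, h1, h2⟩ := ih (fun k => f k.succ) (fun k => hf _)
    obtain ⟨δ', h3, h4⟩ := h.dir _ _ h1 (hf 0)
    refine ⟨δ', h3, fun k => ?_⟩
    refine Fin.cases (fun x hx => (h4 x hx).2) (fun k x hx => h2 k x (h4 x hx).1) k

/-- sets containing a member of the family -/
def QQ {n : ℕ} (W : Δ → Prop) (S : Δ → (Fin n → M) → Prop) (X : (Fin n → M) → Prop) : Prop :=
  ∃ δ, W δ ∧ ∀ x, S δ x → X x

theorem QQ.and {n : ℕ} {W : Δ → Prop} {S : Δ → (Fin n → M) → Prop} (h : DFam L M n W S) {X Y : (Fin n → M) → Prop}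
    (hX : QQ W S X) (hY : QQ W S Y) : QQ W S (fun x => X x ∧ Y x) := by
  obtain ⟨a, h1, h2⟩ := hX
  obtain ⟨b, h3, h4⟩ := hY
  obtain ⟨c, h5, h6⟩ := h.dir _ _ h1 h3
  exact ⟨c, h5, fun x hx => ⟨h2 x (h6 x hx).1, h4 x (h6 x hx).2⟩⟩

theorem QQ.up {n : ℕ} {W : Δ → Prop} {S : Δ → (Fin n → M) → Prop} {X Y : (Fin n → M) → Prop}
    (hX : QQ W S X) (h : ∀ x, X x → Y x) : QQ W S Y := by
  obtain ⟨a, h1, h2⟩ := hX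
  exact ⟨a, h1, fun x hx => h x (h2 x hx)⟩

theorem QQ.ne {n : ℕ} {W : Δ → Prop} {S : Δ → (Fin n → M) → Prop} (h : DFam L M n W S) {X : (Fin n → M) → Prop}
    (hX : QQ W S X) : ∃ x, X x := by
  obtain ⟨a, h1, h2⟩ := hX
  obtain ⟨x, hx⟩ := h.ne a h1
  exact ⟨x, h2 x hx⟩

theorem QQ.self {n : ℕ} {W : Δ → Prop} {S : Δ → (Fin n → M) → Prop} {δ : Δ} (h : W δ) : QQ W S (S δ) := ⟨δ, h, fun _ => id⟩

variable (L M) in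
def Complete (n : ℕ) {Δ : Type u} [DSpace M Δ] (W : Δ → Prop) (S : Δ → (Fin n → M) → Prop) : Prop :=
  ∀ X, Def L M X → QQ W S X ∨ QQ W S (fun x => ¬ X x)

theorem QQ.fex {n : ℕ} {W : Δ → Prop} {S : Δ → (Fin n → M) → Prop} (h : DFam L M n W S) (hc : Complete L M n W S) {N : ℕ}
    {X : Fin N → (Fin n → M) → Prop} (hX : ∀ k, Def L M (X k)) {Z : (Fin n → M) → Prop} (hZ : QQ W S Z)
    (hZX : ∀ x, Z x → ∃ k, X k x) : ∃ k, QQ W S (X k) := by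
  induction N generalizing Z with
  | zero =>
    obtain ⟨x, hx⟩ := hZ.ne h
    exact (hZX x hx).choose.elim0
  | succ N ih =>
    rcases hc _ (hX 0) with h0 | h0
    · exact ⟨0, h0⟩
    · obtain ⟨k, hk⟩ := ih (X := fun k => X k.succ) (fun k => hX _) (hZ.and h h0) (by
        rintro x ⟨h2, h3⟩
        obtain ⟨k, hk⟩ := hZX x h2
        revert hk
        refine Fin.cases (fun hk => absurd hk h3) (fun k hk => ⟨k, hk⟩) k)
      exact ⟨k.succ, hk⟩

theorem QQ.dfn {n : ℕ} {W : Δ → Prop} {S : Δ → (Fin n → M) → Prop} (h : DFam L M n W S) {X : Γ → (Fin n → M) → Prop}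
    (hX : Def L M (fun q : Γ × (Fin n → M) => X q.1 q.2)) : Def L M (fun γ => QQ W S (X γ)) := by
  have h1 := h.dW
  have h2 := h.dS
  show Def L M (fun γ => ∃ δ, W δ ∧ ∀ x, S δ x → X γ x)
  exact autodef

/-- The conclusion of the completion theorem. -/
def HasCompl (L : FirstOrder.Language) (M : Type u) [L.Structure M] [LinearOrder M] [OM L M] (n : ℕ)
    {Δ : Type u} [DSpace M Δ] (W : Δ → Prop) (S : Δ → (Fin n → M) → Prop) : Prop :=
  ∃ (Θ : Type u) (_ : DSpace M Θ) (W' : Θ → Prop) (G : Θ → (Fin n → M) → Prop), DFam L M n W' G ∧ Complete L M n W' G ∧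
    ∀ δ, W δ → QQ W' G (S δ)

variable [TopologicalSpace M] [OrderTopology M] [DenselyOrdered M] [NoMinOrder M] [NoMaxOrder M] [Nonempty M]

/-- Lifting along a partial section. -/
theorem lift_section {n : ℕ} (ih : ∀ (Δ : Type u) [DSpace M Δ] (W : Δ → Prop) (S : Δ → (Fin n → M) → Prop), DFam L M n W S →
    HasCompl L M n W S) {W : Δ → Prop} {F : Δ → (Fin (n+1) → M) → Prop} (hF : DFam L M (n+1) W F)
    {Y : (Fin (n+1) → M) → Prop} (hY : Def L M Y) (hu : ∀ x y y', Y (Fin.cons y x) → Y (Fin.cons y' x) → y = y')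
    (hm : ∀ f, W f → ∃ w, F f w ∧ Y w) : HasCompl L M (n+1) W F := by
  have hdW := hF.dW
  have hdF := hF.dS
  have hH : DFam L M n W (fun f x => ∃ y, F f (Fin.cons y x) ∧ Y (Fin.cons y x)) := by
    refine ⟨hdW, autodef, hF.ex, ?_, ?_⟩
    · intro f hf
      obtain ⟨w, h1, h2⟩ := hm f hf
      exact ⟨Fin.tail w, w 0, by simpa using h1, by simpa using h2⟩
    · intro f f' hf hf'
      obtain ⟨g, h1, h2⟩ := hF.dir f f' hf hf'
      refine ⟨g, h1, ?_⟩
      rintro x ⟨y, h3, h4⟩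
      exact ⟨⟨y, (h2 _ h3).1, h4⟩, ⟨y, (h2 _ h3).2, h4⟩⟩
  obtain ⟨Θ, _, W', G, hG, hGc, hGf⟩ := ih Δ W _ hH
  have hdW' := hG.dW
  have hdG := hG.dS
  refine ⟨Θ, inferInstance, W', fun θ w => G θ (Fin.tail w) ∧ Y w, ⟨hdW', autodef, hG.ex, ?_, ?_⟩, ?_, ?_⟩
  · intro θ hθ
    obtain ⟨f, hf⟩ := hF.ex
    obtain ⟨x, h1, y, h2, h3⟩ := ((QQ.self hθ).and hG (hGf f hf)).ne hG
    exact ⟨Fin.cons y x, by simpa using h1, h3⟩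
  · intro θ θ' h h'
    obtain ⟨g, h1, h2⟩ := hG.dir θ θ' h h'
    exact ⟨g, h1, fun x hx => ⟨⟨(h2 _ hx.1).1, hx.2⟩, ⟨(h2 _ hx.1).2, hx.2⟩⟩⟩
  · intro X hX
    rcases hGc (fun x => ∃ y, Y (Fin.cons y x) ∧ X (Fin.cons y x)) autodef with ⟨θ, h1, h2⟩ | ⟨θ, h1, h2⟩
    · refine Or.inl ⟨θ, h1, ?_⟩
      rintro w ⟨h3, h4⟩
      obtain ⟨y, h5, h6⟩ := h2 _ h3
      have : y = w 0 := hu (Fin.tail w) _ _ h5 (by simpa using h4)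
      subst this
      simpa using h6
    · refine Or.inr ⟨θ, h1, ?_⟩
      rintro w ⟨h3, h4⟩ h5
      exact h2 _ h3 ⟨w 0, by simpa using h4, by simpa using h5⟩
  · intro f hf
    obtain ⟨θ, h1, h2⟩ := hGf f hf
    refine ⟨θ, h1, ?_⟩
    rintro w ⟨h3, h4⟩
    obtain ⟨y, h5, h6⟩ := h2 _ h3
    have : y = w 0 := hu (Fin.tail w) _ _ h6 (by simpa using h4)
    subst this
    simpa using h5

theorem HasCompl.mono {n : ℕ} {W : Δ → Prop} {S : Δ → (Fin n → M) → Prop} {W' : Θ → Prop} {S' : Θ → (Fin n → M) → Prop}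
    (h : HasCompl L M n W S) (hf : ∀ θ, W' θ → QQ W S (S' θ)) : HasCompl L M n W' S' := by
  obtain ⟨Λ, _, V, G, h1, h2, h3⟩ := h
  refine ⟨Λ, inferInstance, V, G, h1, h2, fun θ hθ => ?_⟩
  obtain ⟨δ, h4, h5⟩ := hf θ hθ
  exact (h3 δ h4).up h5

/-- Families with convex fibers over a complete family. -/
theorem compl_conv {n : ℕ} (ih : ∀ (Δ : Type u) [DSpace M Δ] (W : Δ → Prop) (S : Δ → (Fin n → M) → Prop), DFam L M n W S →
    HasCompl L M n W S) {W : Δ → Prop} {F : Δ → (Fin (n+1) → M) → Prop} (hF : DFam L M (n+1) W F)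
    (hconv : ∀ f x y y' z, F f (Fin.cons y x) → F f (Fin.cons y' x) → y ≤ z → z ≤ y' → F f (Fin.cons z x))
    {W1 : Θ → Prop} {G : Θ → (Fin n → M) → Prop} (hG : DFam L M n W1 G) (hGc : Complete L M n W1 G)
    (hsh : ∀ f X, W f → QQ W1 G X → ∃ f', W f' ∧ ∀ w, F f' w → F f w ∧ X (Fin.tail w)) : HasCompl L M (n+1) W F := by
  have hdW := hF.dW
  have hdF := hF.dS
  by_cases hY : ∃ Y : (Fin (n+1) → M) → Prop, Def L M Y ∧ (∀ x : Fin n → M, {y | Y (Fin.cons y x)}.Finite) ∧ ∀ f, W f → ∃ w, F f w ∧ Y w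
  · obtain ⟨Y, hYd, hYf, hYm⟩ := hY
    have hY2 : Def L M (fun p : (Fin n → M) × M => (fun x y => Y (Fin.cons y x)) p.1 p.2) := autodef
    obtain ⟨N, hN⟩ := unif_alt (L := L) (D := fun (x : Fin n → M) y => Y (Fin.cons y x)) hY2
    have hck : ∀ k, Def L M (fun p : (Fin n → M) × M => Cmp (fun y => Y (Fin.cons y p.1)) k p.2) := fun k =>
      def_cmp (D := fun (x : Fin n → M) y => Y (Fin.cons y x)) hY2 k
    have hck' : ∀ k, Def L M (fun w : Fin (n+1) → M => Cmp (fun y => Y (Fin.cons y (Fin.tail w))) k (w 0)) := fun k =>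
      Def.comp2 (P := fun (x : Fin n → M) y => Cmp (fun y => Y (Fin.cons y x)) k y) (hck k) autodef autodef
    have hk : ∃ k : Fin N, ∀ f, W f → ∃ w, F f w ∧ Cmp (fun y => Y (Fin.cons y (Fin.tail w))) k (w 0) := by
      by_contra hn
      push Not at hn
      choose f hf hf2 using hn
      obtain ⟨g, hg1, hg2⟩ := hF.fin f hf
      obtain ⟨w, h1, h2⟩ := hYm g hg1
      obtain ⟨k, hk⟩ := exists_cmp (D := fun y => Y (Fin.cons y (Fin.tail w))) (fun y => hN (Fin.tail w) y) (y := w 0) (by simpa using h2)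
      exact hf2 k w (hg2 k w h1) hk
    obtain ⟨k, hk⟩ := hk
    refine lift_section ih hF (hck' k) ?_ hk
    intro x
    have key : ∀ y y', y < y' → Cmp (fun y => Y (Fin.cons y x)) k y → Cmp (fun y => Y (Fin.cons y x)) k y' → False := by
      intro y y' hlt h1 h2
      refine (Ioo_infinite hlt).mono ?_ (hYf x)
      intro z hz
      exact (h1.conv h2 hz.1.le hz.2.le).mem
    intro y y' h1 h2
    simp only [Fin.tail_cons, Fin.cons_zero] at h1 h2
    rcases lt_trichotomy y y' with e | e | e
    · exact (key _ _ e h1 h2).elim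
    · exact e
    · exact (key _ _ e h2 h1).elim
  · refine ⟨Δ, inferInstance, W, F, hF, ?_, fun δ h => QQ.self h⟩
    intro X hX
    have hX2 : Def L M (fun p : (Fin n → M) × M => (fun x y => X (Fin.cons y x)) p.1 p.2) := autodef
    have hXx : ∀ x : Fin n → M, Def L M (fun y => X (Fin.cons y x)) := fun x => autodef
    have : ∃ f, W f ∧ ∀ w, F f w → ∀ᶠ z in 𝓝 (w 0), (X (Fin.cons z (Fin.tail w)) ↔ X (Fin.cons (w 0) (Fin.tail w))) := by
      by_contra hn
      refine hY ⟨fun w => ¬ ∀ᶠ z in 𝓝 (w 0), (X (Fin.cons z (Fin.tail w)) ↔ X (Fin.cons (w 0) (Fin.tail w))), autodef, ?_, ?_⟩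
      · intro x
        simp only [Fin.tail_cons, Fin.cons_zero]
        exact bdry_finite (hXx x)
      · intro f hf
        by_contra hc
        refine hn ⟨f, hf, fun w hw => ?_⟩
        by_contra h2
        exact hc ⟨w, hw, h2⟩
    obtain ⟨f, hf, hf2⟩ := this
    have hcst0 : ∀ x y y', y ≤ y' → F f (Fin.cons y x) → F f (Fin.cons y' x) → (X (Fin.cons y x) ↔ X (Fin.cons y' x)) := by
      intro x y y' hle h1 h2
      refine locconst (hXx x) hle fun c hc1 hc2 => ?_
      simpa using hf2 _ (hconv f x y y' c h1 h2 hc1 hc2)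
    have hcst : ∀ x y y', F f (Fin.cons y x) → F f (Fin.cons y' x) → (X (Fin.cons y x) ↔ X (Fin.cons y' x)) := by
      intro x y y' h1 h2
      rcases le_total y y' with e | e
      · exact hcst0 x y y' e h1 h2
      · exact (hcst0 x y' y e h2 h1).symm
    rcases hGc (fun x => ∃ y, F f (Fin.cons y x) ∧ X (Fin.cons y x)) autodef with hq | hq
    · obtain ⟨f', h1, h2⟩ := hsh f _ hf hq
      refine Or.inl ⟨f', h1, fun w hw => ?_⟩
      obtain ⟨h3, y, h4, h5⟩ := h2 w hw
      have := (hcst (Fin.tail w) y (w 0) h4 (by simpa using h3)).1 h5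
      simpa using this
    · obtain ⟨f', h1, h2⟩ := hsh f _ hf hq
      refine Or.inr ⟨f', h1, fun w hw hx => ?_⟩
      obtain ⟨h3, h4⟩ := h2 w hw
      exact h4 ⟨w 0, by simpa using h3, by simpa using hx⟩

end
end OMinAux

open FirstOrder Set
namespace OMinAux
open Filter Topology
section
variable {L : FirstOrder.Language} {M : Type u} [L.Structure M] [LinearOrder M] [OM L M]
variable {Γ Δ Θ Λ : Type u} [DSpace M Γ] [DSpace M Δ] [DSpace M Θ] [DSpace M Λ]
variable [TopologicalSpace M] [OrderTopology M] [DenselyOrdered M] [NoMinOrder M] [NoMaxOrder M] [Nonempty M]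

theorem step_b (n : ℕ) : ∀ (Δ : Type u) [DSpace M Δ] (W : Δ → Prop) (S : Δ → (Fin n → M) → Prop), DFam L M n W S →
    HasCompl L M n W S := by
  induction n with
  | zero =>
    intro Δ _ W S h
    refine ⟨Δ, inferInstance, W, S, h, ?_, fun δ h => QQ.self h⟩
    intro X hX
    obtain ⟨δ, hδ⟩ := h.ex
    by_cases hx : X (fun i => i.elim0)
    · exact Or.inl ⟨δ, hδ, fun x _ => by rwa [Subsingleton.elim x (fun i => i.elim0)]⟩
    · exact Or.inr ⟨δ, hδ, fun x _ => by rwa [Subsingleton.elim x (fun i => i.elim0)]⟩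
  | succ n ih =>
    intro Δ _ W S hS
    have hdW := hS.dW
    have hdS := hS.dS
    have hpi : DFam L M n W (fun δ x => ∃ y, S δ (Fin.cons y x)) := by
      refine ⟨hdW, autodef, hS.ex, ?_, ?_⟩
      · intro δ hδ
        obtain ⟨w, hw⟩ := hS.ne δ hδ
        exact ⟨Fin.tail w, w 0, by simpa using hw⟩
      · intro δ δ' h h'
        obtain ⟨δ'', h1, h2⟩ := hS.dir δ δ' h h'
        exact ⟨δ'', h1, fun x ⟨y, hy⟩ => ⟨⟨y, (h2 _ hy).1⟩, ⟨y, (h2 _ hy).2⟩⟩⟩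
    obtain ⟨Θ, _, W1, G, hG, hGc, hGf⟩ := ih Δ W _ hpi
    have hdW1 := hG.dW
    have hdG := hG.dS
    have hX2 : Def L M (fun r : (Δ × (Fin n → M)) × M => S r.1.1 (Fin.cons r.2 r.1.2)) := autodef
    obtain ⟨N, hN⟩ := unif_alt (L := L) (D := fun (r : Δ × (Fin n → M)) y => S r.1 (Fin.cons y r.2)) hX2
    obtain ⟨c, hc⟩ := exists_consts (M := M) N
    have hcmp : ∀ k : ℕ, Def L M (fun r : (Δ × (Fin n → M)) × M => Cmp (fun y => S r.1.1 (Fin.cons y r.1.2)) k r.2) :=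
      fun k => def_cmp (D := fun (r : Δ × (Fin n → M)) y => S r.1 (Fin.cons y r.2)) hX2 k
    have hcmp' : ∀ k : ℕ, Def L M (fun r : Δ × (Fin n → M) × M => Cmp (fun y => S r.1 (Fin.cons y r.2.1)) k r.2.2) := fun k =>
      Def.comp2 (P := fun (r : Δ × (Fin n → M)) y => Cmp (fun y => S r.1 (Fin.cons y r.2)) k y)
        (f := fun r : Δ × (Fin n → M) × M => (r.1, r.2.1)) (g := fun r => r.2.2) (hcmp k) autodef autodef
    obtain ⟨T, hT⟩ : ∃ T : ℕ → Δ → (Fin n → M) → M → Prop, T = fun k u x y => Cmp (fun y => S u (Fin.cons y x)) k y := ⟨_, rfl⟩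
    have hTd : ∀ k, Def L M (fun r : Δ × (Fin n → M) × M => T k r.1 r.2.1 r.2.2) := by
      rw [hT]; exact hcmp'
    have hT0 := hTd 0
    have hTmem : ∀ k u x y, T k u x y → S u (Fin.cons y x) := by
      rw [hT]; exact fun k u x y h => h.mem
    have hTconv : ∀ k u x y y' z, T k u x y → T k u x y' → y ≤ z → z ≤ y' → T k u x z := by
      rw [hT]; exact fun k u x y y' z h h' h1 h2 => h.conv h' h1 h2
    have hTlt : ∀ k j u x y y', T k u x y → T j u x y' → k < j → y < y' := by
      rw [hT]; exact fun k j u x y y' h h' h1 => h.lt h' h1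
    have hTne : ∀ u x, (∃ y, S u (Fin.cons y x)) → ∃ y, T 0 u x y := by
      rw [hT]; exact fun u x h => first_ex (fun y => hN (u, x) y) h
    have hTex : ∀ u x y, S u (Fin.cons y x) → ∃ k : Fin N, T k u x y := by
      rw [hT]; exact fun u x y h => exists_cmp (fun y => hN (u, x) y) h
    have hTsub : ∀ u x (C : M → Prop), (∀ y, C y → S u (Fin.cons y x)) → (∀ y y' z, C y → C y' → y ≤ z → z ≤ y' → C z) →
        ∀ k y y', C y → T k u x y → C y' → T k u x y' := by
      rw [hT]; exact fun u x C h1 h2 k y y' h3 h4 h5 => Cmp.conv_sub h1 h2 h3 h4 h5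
    clear hT hcmp hcmp' hN
    -- the index of the first component of `w` inside `u`
    let Φ : ℕ → Δ → Δ → Prop := fun k u w => QQ W1 G (fun x => ∀ y, T 0 w x y → T k u x y)
    have hΦex : ∀ u w, W w → (∀ v, S w v → S u v) → ∃ k : Fin N, Φ k u w := by
      intro u w hw hsub
      refine QQ.fex hG hGc (fun k => ?_) (hGf w hw) ?_
      · have := hTd k
        exact autodef
      · intro x hx
        obtain ⟨y, hy⟩ := hTne w x hx
        obtain ⟨k, hk⟩ := hTex u x y (hsub _ (hTmem _ _ _ _ hy))
        exact ⟨k, fun y' hy' => hTsub u x (T 0 w x) (fun y h => hsub _ (hTmem _ _ _ _ h)) (hTconv 0 w x) k y y' hy hk hy'⟩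
    have hΦmono : ∀ u w w' k k', W w → W w' → (∀ v, S w' v → S w v) → Φ k u w → Φ k' u w' → k ≤ k' := by
      intro u w w' k k' hw hw' hsub h1 h2
      obtain ⟨x, ⟨h3, h4⟩, h5⟩ := ((h1.and hG h2).and hG (hGf w' hw')).ne hG
      obtain ⟨y', hy'⟩ := hTne w' x h5
      have hy2 := hsub _ (hTmem _ _ _ _ hy')
      have : ∃ y, T 0 w x y ∧ y ≤ y' := by
        obtain ⟨j, hj⟩ := hTex w x y' hy2
        rcases Nat.eq_zero_or_pos (j : ℕ) with e | e
        · rw [e] at hj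
          exact ⟨y', hj, le_rfl⟩
        · obtain ⟨y, hy⟩ := hTne w x ⟨_, hy2⟩
          exact ⟨y, hy, (hTlt _ _ _ _ _ _ hy hj e).le⟩
      obtain ⟨y, hy, hle⟩ := this
      by_contra hlt
      exact absurd (hTlt _ _ _ _ _ _ (h4 _ hy') (h3 _ hy) (not_le.1 hlt)) (not_lt.2 hle)
    have hstab : ∀ u, W u → ∃ k : Fin N, ∃ z, W z ∧ (∀ v, S z v → S u v) ∧ ∀ w, W w → (∀ v, S w v → S z v) → Φ k u w := by
      intro u hu
      classical
      let P : ℕ → Prop := fun k => ∃ w, W w ∧ (∀ v, S w v → S u v) ∧ Φ (N - k) u w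
      have hP : ∃ k, P k := by
        obtain ⟨k, hk⟩ := hΦex u u hu (fun _ => id)
        refine ⟨N - k, u, hu, fun _ => id, ?_⟩
        rwa [Nat.sub_sub_self k.2.le]
      obtain ⟨z, hz1, hz2, hz3⟩ := Nat.find_spec hP
      have key : ∀ w, W w → (∀ v, S w v → S z v) → ∃ k : Fin N, (k : ℕ) = N - Nat.find hP ∧ Φ k u w := by
        intro w hw hwz
        obtain ⟨k, hk⟩ := hΦex u w hw (fun v hv => hz2 v (hwz v hv))
        refine ⟨k, ?_, hk⟩
        have h1 := hΦmono u z w _ _ hz1 hw hwz hz3 hk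
        have h2 : Nat.find hP ≤ N - k := Nat.find_min' hP ⟨w, hw, fun v hv => hz2 v (hwz v hv), by rwa [Nat.sub_sub_self k.2.le]⟩
        have := k.2
        omega
      obtain ⟨k, hk, hk2⟩ := key z hz1 (fun _ => id)
      refine ⟨k, z, hz1, hz2, fun w hw hwz => ?_⟩
      obtain ⟨k', e, h⟩ := key w hw hwz
      rwa [hk, ← e]
    -- encode the index as an element of M
    obtain ⟨C, hCdef⟩ : ∃ C : (Δ × M) → (Fin n → M) → M → Prop, C = fun t x y =>
      ∃ k : Fin N, t.2 = c k ∧ T k t.1 x y := ⟨_, rfl⟩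
    have hCd : Def L M (fun r : (Δ × M) × (Fin n → M) × M => C r.1 r.2.1 r.2.2) := by
      rw [hCdef]
      refine Def.fex fun k => Def.and autodef ?_
      have := hTd k
      exact autodef
    have hCmem : ∀ t x y, C t x y → S t.1 (Fin.cons y x) := by
      rw [hCdef]
      rintro t x y ⟨k, _, h⟩
      exact hTmem _ _ _ _ h
    have hCconv : ∀ t x y y' z, C t x y → C t x y' → y ≤ z → z ≤ y' → C t x z := by
      rw [hCdef]
      rintro t x y y' z ⟨k, hk, h1⟩ ⟨k', hk', h2⟩ h3 h4
      have : k = k' := hc (hk.symm.trans hk')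
      subst this
      exact ⟨k, hk, hTconv _ _ _ _ _ _ h1 h2 h3 h4⟩
    have hCsub : ∀ t x (E : M → Prop), (∀ y, E y → S t.1 (Fin.cons y x)) → (∀ y y' z, E y → E y' → y ≤ z → z ≤ y' → E z) →
        ∀ y y', E y → C t x y → E y' → C t x y' := by
      rw [hCdef]
      rintro t x E h1 h2 y y' h3 ⟨k, hk, h4⟩ h5
      exact ⟨k, hk, hTsub _ _ E h1 h2 k y y' h3 h4 h5⟩
    let Ψ : (Δ × M) → Δ → Prop := fun t w => QQ W1 G (fun x => ∀ y, T 0 w x y → C t x y)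
    have hΨd : Def L M (fun r : (Δ × M) × Δ => Ψ r.1 r.2) :=
      QQ.dfn hG (X := fun (r : (Δ × M) × Δ) x => ∀ y, T 0 r.2 x y → C r.1 x y) autodef
    have hΨ : ∀ t w, Ψ t w → QQ W1 G (fun x => ∀ y, T 0 w x y → C t x y) := fun t w h => h
    let St : (Δ × M) → Prop := fun t => W t.1 ∧ ∃ z, W z ∧ (∀ v, S z v → S t.1 v) ∧ ∀ w, W w → (∀ v, S w v → S z v) → Ψ t w
    have hStdef : ∀ t, St t ↔ W t.1 ∧ ∃ z, W z ∧ (∀ v, S z v → S t.1 v) ∧ ∀ w, W w → (∀ v, S w v → S z v) → Ψ t w :=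
      fun t => Iff.rfl
    have hStex : ∀ u, W u → ∃ t, t.1 = u ∧ St t := by
      intro u hu
      obtain ⟨k, z, h1, h2, h3⟩ := hstab u hu
      refine ⟨(u, c k), rfl, hu, z, h1, h2, fun w hw hwz => ?_⟩
      refine (h3 w hw hwz).up fun x hx y hy => ?_
      rw [hCdef]
      exact ⟨k, rfl, hx y hy⟩
    clear_value Ψ
    have hStd : Def L M St := by
      show Def L M (fun t : Δ × M => W t.1 ∧ ∃ z, W z ∧ (∀ v, S z v → S t.1 v) ∧ ∀ w, W w → (∀ v, S w v → S z v) → Ψ t w)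
      exact autodef
    clear_value St
    clear hCdef hstab hΦmono hΦex
    let F : ((Δ × M) × Θ) → (Fin (n+1) → M) → Prop := fun r w => C r.1 (Fin.tail w) (w 0) ∧ G r.2 (Fin.tail w)
    have hdir0 : ∀ t t', St t → St t' → ∃ t'', St t'' ∧ QQ W1 G (fun x => ∀ y, C t'' x y → C t x y ∧ C t' x y) := by
      intro t t' h h'
      obtain ⟨h1, z, h2, h3, h4⟩ := (hStdef t).1 h
      obtain ⟨h1', z', h2', h3', h4'⟩ := (hStdef t').1 h'
      obtain ⟨w, hw1, hw2⟩ := hS.dir z z' h2 h2'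
      obtain ⟨t'', rfl, ht⟩ := hStex w hw1
      refine ⟨t'', ht, ?_⟩
      obtain ⟨_, z'', k1, k2, k3⟩ := (hStdef _).1 ht
      have e1 := hΨ _ _ (k3 z'' k1 (fun _ => id))
      have e2 := hΨ _ _ (h4 z'' k1 (fun v hv => (hw2 v (k2 v hv)).1))
      have e3 := hΨ _ _ (h4' z'' k1 (fun v hv => (hw2 v (k2 v hv)).2))
      refine ((e1.and hG (e2.and hG e3)).and hG (hGf z'' k1)).up ?_
      rintro x ⟨⟨m1, m2, m3⟩, m4⟩ y hy
      obtain ⟨y0, hy0⟩ := hTne z'' x m4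
      exact ⟨hCsub t x (C t'' x) (fun y h => h3 _ (hw2 _ (hCmem _ _ _ h)).1) (hCconv t'' x) y0 y (m1 _ hy0) (m2 _ hy0) hy,
        hCsub t' x (C t'' x) (fun y h => h3' _ (hw2 _ (hCmem _ _ _ h)).2) (hCconv t'' x) y0 y (m1 _ hy0) (m3 _ hy0) hy⟩
    have hFd : DFam L M (n+1) (fun r : (Δ × M) × Θ => St r.1 ∧ W1 r.2) F := by
      refine ⟨autodef, ?_, ?_, ?_, ?_⟩
      · show Def L M (fun q : ((Δ × M) × Θ) × (Fin (n+1) → M) => C q.1.1 (Fin.tail q.2) (q.2 0) ∧ G q.1.2 (Fin.tail q.2))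
        exact autodef
      · obtain ⟨u, hu⟩ := hS.ex
        obtain ⟨t, -, ht⟩ := hStex u hu
        obtain ⟨η, hη⟩ := hG.ex
        exact ⟨(t, η), ht, hη⟩
      · rintro ⟨t, η⟩ ⟨ht, hη⟩
        obtain ⟨h1, z, h2, h3, h4⟩ := (hStdef t).1 ht
        obtain ⟨x, ⟨m1, m2⟩, m3⟩ := (((hΨ _ _ (h4 z h2 (fun _ => id))).and hG (hGf z h2)).and hG (QQ.self hη)).ne hG
        obtain ⟨y0, hy0⟩ := hTne z x m2
        exact ⟨Fin.cons y0 x, by simpa using m1 _ hy0, by simpa using m3⟩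
      · rintro ⟨t, η⟩ ⟨t', η'⟩ ⟨ht, hη⟩ ⟨ht', hη'⟩
        obtain ⟨t'', h1, h2⟩ := hdir0 t t' ht ht'
        obtain ⟨η'', h3, h4⟩ := (h2.and hG ((QQ.self hη).and hG (QQ.self hη')))
        refine ⟨(t'', η''), ⟨h1, h3⟩, ?_⟩
        rintro w ⟨h5, h6⟩
        obtain ⟨h7, h8, h9⟩ := h4 _ h6
        exact ⟨⟨(h7 _ h5).1, h8⟩, ⟨(h7 _ h5).2, h9⟩⟩
    refine (compl_conv ih hFd ?_ hG hGc ?_).mono ?_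
    · rintro ⟨t, η⟩ x y y' z ⟨h1, h2⟩ ⟨h3, h4⟩ h5 h6
      simp only [Fin.tail_cons, Fin.cons_zero] at h1 h2 h3
      exact ⟨by simpa using hCconv _ _ _ _ _ h1 h3 h5 h6, by simpa using h2⟩
    · rintro ⟨t, η⟩ X ⟨ht, hη⟩ hX
      obtain ⟨η', h1, h2⟩ := (QQ.self hη).and hG hX
      refine ⟨(t, η'), ⟨ht, h1⟩, ?_⟩
      rintro w ⟨h3, h4⟩
      exact ⟨⟨h3, (h2 _ h4).1⟩, (h2 _ h4).2⟩
    · intro u hu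
      obtain ⟨t, rfl, ht⟩ := hStex u hu
      obtain ⟨η, hη⟩ := hG.ex
      refine ⟨(t, η), ⟨ht, hη⟩, ?_⟩
      rintro w ⟨h3, h4⟩
      simpa using hCmem _ _ _ h3

end
end OMinAux

open FirstOrder Set
namespace OMinAux
open Filter Topology
section
variable {L : FirstOrder.Language} {M : Type u} [L.Structure M] [LinearOrder M]
variable {Γ Δ Θ Λ : Type u} [DSpace M Γ] [DSpace M Δ] [DSpace M Θ] [DSpace M Λ]

theorem OM_of (hM : IsOMinimal L M) : OM L M := by
  classical
  obtain ⟨h1, h2, h3, h4, h5, h6⟩ := hM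
  refine ⟨h1, h2, h3, h4, ?_, ?_⟩
  · have := (h5.mono (empty_subset (univ : Set M))).preimage_comp (![Sum.inl (), Sum.inr ()] : Fin 2 → Unit ⊕ Unit)
    exact this
  · intro P hP
    have hd : Set.Definable₁ (Set.univ : Set M) L {x | P x} := by
      have := Definable.preimage_comp (fun _ : Unit => (0 : Fin 1)) hP
      exact this
    obtain ⟨F, hF, hF2⟩ := h6 _ hd
    have key : ∀ t ∈ F, ∃ B : Finset M, ∀ a b, a ≤ b → (∀ z ∈ B, a ≤ z → z ≤ b → False) → (a ∈ t ↔ b ∈ t) := by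
      intro t ht
      rcases hF2 t ht with ⟨c, rfl⟩ | ⟨c, d, rfl⟩ | ⟨c, rfl⟩ | ⟨c, rfl⟩ | rfl
      · refine ⟨{c}, fun a b hab h => ?_⟩
        have := h c (by simp)
        simp only [mem_singleton_iff]
        grind
      · refine ⟨{c, d}, fun a b hab h => ?_⟩
        have h1 := h c (by simp)
        have h2 := h d (by simp)
        simp only [mem_Ioo]
        grind
      · refine ⟨{c}, fun a b hab h => ?_⟩
        have := h c (by simp)
        simp only [mem_Ioi]
        grind
      · refine ⟨{c}, fun a b hab h => ?_⟩
        have := h c (by simp)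
        simp only [mem_Iio]
        grind
      · exact ⟨∅, fun a b _ _ => by simp⟩
    choose! B hB using key
    refine ⟨F.biUnion B, fun a b hab h => ?_⟩
    have e : ∀ x, P x ↔ ∃ t ∈ F, x ∈ t := by
      intro x
      have : x ∈ {x | P x} ↔ x ∈ ⋃₀ (F : Set (Set M)) := by rw [hF]
      simpa using this
    rw [e, e]
    have : ∀ t ∈ F, (a ∈ t ↔ b ∈ t) := fun t ht => hB t ht a b hab fun z hz => h z (Finset.mem_biUnion.2 ⟨t, ht, hz⟩)
    exact ⟨fun ⟨t, h1, h2⟩ => ⟨t, h1, (this t h1).1 h2⟩, fun ⟨t, h1, h2⟩ => ⟨t, h1, (this t h1).2 h2⟩⟩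

theorem def_pi_iff {ι : Type} [Finite ι] {X : Set (ι → M)} : Def L M (fun x : ι → M => x ∈ X) ↔ (univ : Set M).Definable L X := Iff.rfl

theorem def_sum {m n : ℕ} {D : Set (Fin m ⊕ Fin n → M)} (hD : (univ : Set M).Definable L D) :
    Def L M (fun q : (Fin m → M) × (Fin n → M) => Sum.elim q.1 q.2 ∈ D) := by
  have h : Def L M (fun x : Fin m ⊕ Fin n → M => x ∈ D) := hD
  refine h.ren (fun q : (Fin m → M) × (Fin n → M) => Sum.elim q.1 q.2) id ?_
  rintro x (i | i) <;> rfl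

theorem exists_coord (Θ : Type u) [DSpace M Θ] : ∃ (m : ℕ) (e : (Fin m → M) ≃ Θ), DMap L M (fun v => e v) := by
  obtain ⟨n, ⟨f⟩⟩ := Finite.exists_equiv_fin (DSpace.ι M Θ)
  let e : (Fin n → M) ≃ Θ := (Equiv.arrowCongr f.symm (Equiv.refl M)).trans (DSpace.e (M := M)).symm
  refine ⟨n, e, dmap_of_ren _ (fun i => f i) ?_⟩
  intro v i
  simp [e]
  rfl

theorem isDefFamily_of {n : ℕ} {W : Θ → Prop} {G : Θ → (Fin n → M) → Prop} (hW : Def L M W)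
    (hG : Def L M (fun q : Θ × (Fin n → M) => G q.1 q.2)) :
    IsDefFamily L (univ : Set M) n {X | ∃ θ, W θ ∧ X = {x | G θ x}} := by
  obtain ⟨m, e, he⟩ := exists_coord (L := L) (M := M) Θ
  have h1 : Def L M (fun v : Fin m → M => W (e v)) := hW.comp he
  have i1 : DMap L M (fun v : Fin m ⊕ Fin n → M => (fun i => v (Sum.inl i) : Fin m → M)) :=
    dmap_of_ren _ (fun i => Sum.inl i) (fun _ _ => rfl)
  have i2 : DMap L M (fun v : Fin m ⊕ Fin n → M => (fun i => v (Sum.inr i) : Fin n → M)) :=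
    dmap_of_ren _ (fun i => Sum.inr i) (fun _ _ => rfl)
  have h2 : Def L M (fun v : Fin m ⊕ Fin n → M => G (e (fun i => v (Sum.inl i))) (fun i => v (Sum.inr i))) :=
    Def.comp2 hG (he.comp i1) i2
  refine ⟨m, {v | W (e v)}, {v | G (e (fun i => v (Sum.inl i))) (fun i => v (Sum.inr i))}, h1, h2, ?_⟩
  ext X
  constructor
  · rintro ⟨θ, h, rfl⟩
    refine ⟨e.symm θ, by simpa using h, ?_⟩
    ext v
    simp [famFiber]
  · rintro ⟨v, h, rfl⟩
    exact ⟨e v, h, by ext; simp [famFiber]⟩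

theorem param_of {n : ℕ} {p : Set (Set (Fin n → M))} (hp : IsDefTypeOver L (univ : Set M) n p)
    (Δ : Type u) [DSpace M Δ] (X : Δ → (Fin n → M) → Prop) (hX : Def L M (fun q : Δ × (Fin n → M) => X q.1 q.2)) :
    Def L M (fun δ => {x | X δ x} ∈ p) := by
  obtain ⟨A0, -, hA0⟩ := definable_iff_finitely_definable.1 hX
  obtain ⟨φ, hφ⟩ := definable_iff_exists_formula_sum.1 hA0
  obtain ⟨m, ⟨f⟩⟩ := Finite.exists_equiv_fin ((A0 : Set M) ⊕ DSpace.ι M Δ)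
  let g : (A0 : Set M) ⊕ (DSpace.ι M Δ ⊕ Fin n) → Fin m ⊕ Fin n :=
    Sum.elim (fun a => Sum.inl (f (Sum.inl a))) (Sum.elim (fun a => Sum.inl (f (Sum.inr a))) Sum.inr)
  let D : Set (Fin m ⊕ Fin n → M) := {v | (φ.relabel g).Realize v}
  have hD : (∅ : Set M).Definable L D := empty_definable_iff.2 ⟨φ.relabel g, rfl⟩
  have h1 : Def L M (fun u : Fin m → M => famFiber D u ∈ p) := hp m D hD
  let s : Δ → Fin m → M := fun δ i => Sum.elim (Subtype.val) (DSpace.e (M := M) δ) (f.symm i)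
  have hs : DMap L M s := by
    refine DMap.pi fun i => ?_
    show DMap L M (fun δ => Sum.elim (Subtype.val) (DSpace.e (M := M) δ) (f.symm i))
    rcases f.symm i with a | a
    · exact DMap.const _
    · exact dmap_of_ren _ (fun _ => a) (fun _ _ => rfl)
  refine (h1.comp hs).congr fun δ => ?_
  have : famFiber D (s δ) = {x | X δ x} := by
    ext x
    show (φ.relabel g).Realize (Sum.elim (s δ) x) ↔ X δ x
    rw [Language.Formula.realize_relabel]
    have h2 : Sum.elim (s δ) x ∘ g = Sum.elim Subtype.val (DSpace.e (M := M) (δ, x)) := by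
      ext i
      rcases i with i | i | i
      · simp [g, s]
      · simp [g, s]; rfl
      · simp [g]; rfl
    rw [h2]
    have h3 : DSpace.e (M := M) (δ, x) ∈ {v | X (DSpace.e.symm v : Δ × (Fin n → M)).1 (DSpace.e.symm v : Δ × (Fin n → M)).2} ↔
      DSpace.e (M := M) (δ, x) ∈ {v | φ.Realize (Sum.elim Subtype.val v)} := by rw [hφ]
    simpa using h3.symm
  rw [this]

theorem isT_of [OM L M] {n : ℕ} {p : Set (Set (Fin n → M))} (hp : IsTypeOn L n p) (hd : IsDefTypeOver L (univ : Set M) n p) :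
    IsT L M n (fun X => {x | X x} ∈ p) where
  dfn X hX := hp.1 _ hX
  bot h := hp.2.1 (by simpa using h)
  and X Y hX hY := hp.2.2.1 _ hX _ hY
  up X Y hX hY h := hp.2.2.2.1 _ hX _ hY h
  em X hX := hp.2.2.2.2 _ hX
  param Δ _ X hX := param_of hd Δ X hX

end
end OMinAux
open OMinAux

theorem statement0 (L : FirstOrder.Language) (M : Type*) [L.Structure M] [LinearOrder M]
    (hM : IsOMinimal L M) (n : ℕ) (S : Set (Set (Fin n → M)))
    (hS : IsDefFamily L (Set.univ : Set M) n S) :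
    ((∃ p, IsTypeOn L n p ∧ IsDefTypeOver L (Set.univ : Set M) n p ∧ S ⊆ p) ↔
      (∃ D, IsDefFamily L (Set.univ : Set M) n D ∧ DirectedFam D ∧ FinerThan D S)) ∧
    ((∃ D, IsDefFamily L (Set.univ : Set M) n D ∧ DirectedFam D ∧ FinerThan D S) ↔
      (∃ p, IsTypeOn L n p ∧ S ⊆ p ∧ HasDefBasis L (Set.univ : Set M) n p)) := by
  haveI := OM_of hM
  haveI : Nonempty M := hM.1
  haveI : DenselyOrdered M := hM.2.1
  haveI : NoMinOrder M := hM.2.2.1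
  haveI : NoMaxOrder M := hM.2.2.2.1
  letI : TopologicalSpace M := Preorder.topology M
  haveI : OrderTopology M := ⟨rfl⟩
  have h12 : (∃ p, IsTypeOn L n p ∧ IsDefTypeOver L (Set.univ : Set M) n p ∧ S ⊆ p) →
      (∃ D, IsDefFamily L (Set.univ : Set M) n D ∧ DirectedFam D ∧ FinerThan D S) := by
    rintro ⟨p, hp, hpd, hSp⟩
    by_cases hne : S.Nonempty
    · obtain ⟨m, Ω, D, hΩ, hD, rfl⟩ := hS
      have hT := isT_of hp hpd
      have hΩ' : Def L M (fun u : Fin m → M => u ∈ Ω) := hΩ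
      have hD' := def_sum hD
      obtain ⟨_, u0, hu0, rfl⟩ := hne
      obtain ⟨Θ, _, W, G, hW, hG, h1, h2, h3⟩ := step_a n _ hT (Fin m → M) (fun u v => Sum.elim u v ∈ D) hD'
        ⟨u0, hSp ⟨u0, hu0, rfl⟩⟩
      refine ⟨_, isDefFamily_of hW hG, ⟨?_, ?_⟩, ?_⟩
      · rintro ⟨θ, hθ, he⟩
        have := h1 θ hθ
        rw [← he] at this
        exact hp.2.1 this
      · rintro _ ⟨θ, hθ, rfl⟩ _ ⟨θ', hθ', rfl⟩
        obtain ⟨θ'', e1, e2⟩ := h2 θ θ' hθ hθ'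
        exact ⟨_, ⟨θ'', e1, rfl⟩, e2⟩
      · rintro _ ⟨u, hu, rfl⟩
        obtain ⟨θ, e1, e2⟩ := h3 u (hSp ⟨u, hu, rfl⟩)
        exact ⟨_, ⟨θ, e1, rfl⟩, e2⟩
    · rw [Set.not_nonempty_iff_eq_empty] at hne
      subst hne
      exact ⟨∅, hS, ⟨by simp, by simp⟩, by intro X hX; simp at hX⟩
  have h23 : (∃ D, IsDefFamily L (Set.univ : Set M) n D ∧ DirectedFam D ∧ FinerThan D S) →
      (∃ p, IsTypeOn L n p ∧ S ⊆ p ∧ HasDefBasis L (Set.univ : Set M) n p) := by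
    rintro ⟨D, hD, hdir, hfin⟩
    have hSdef : ∀ X ∈ S, (univ : Set M).Definable L X := by
      obtain ⟨m, Ω, E, hΩ, hE, rfl⟩ := hS
      rintro _ ⟨u, hu, rfl⟩
      exact Def.comp2 (P := fun (u : Fin m → M) (v : Fin n → M) => Sum.elim u v ∈ E) (def_sum hE) (DMap.const u) DMap.id
    have hfam : ∃ (m : ℕ) (W : (Fin m → M) → Prop) (F : (Fin m → M) → (Fin n → M) → Prop), DFam L M n W F ∧
        ∀ X ∈ D, ∃ u, W u ∧ ∀ x, F u x → x ∈ X := by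
      by_cases hne : D.Nonempty
      · obtain ⟨m, Ω, E, hΩ, hE, rfl⟩ := hD
        refine ⟨m, fun u => u ∈ Ω, fun u v => Sum.elim u v ∈ E, ⟨hΩ, def_sum hE, ?_, ?_, ?_⟩, ?_⟩
        · obtain ⟨_, u, hu, -⟩ := hne
          exact ⟨u, hu⟩
        · intro u hu
          by_contra hc
          refine hdir.1 ⟨u, hu, ?_⟩
          ext x
          simp only [mem_empty_iff_false, iff_false]
          exact fun hx => hc ⟨x, hx⟩
        · intro u u' hu hu'
          obtain ⟨_, ⟨v, hv, rfl⟩, h⟩ := hdir.2 _ ⟨u, hu, rfl⟩ _ ⟨u', hu', rfl⟩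
          exact ⟨v, hv, fun x hx => h hx⟩
        · rintro _ ⟨u, hu, rfl⟩
          exact ⟨u, hu, fun x hx => hx⟩
      · obtain ⟨c⟩ := hM.1
        exact ⟨0, fun _ => True, fun _ _ => True, ⟨Def.cst _, Def.cst _, ⟨fun i => i.elim0, trivial⟩, fun _ _ => ⟨fun _ => c, trivial⟩,
          fun u _ _ _ => ⟨u, trivial, fun _ _ => ⟨trivial, trivial⟩⟩⟩, fun X hX => absurd ⟨X, hX⟩ hne⟩
    obtain ⟨m, W0, F0, hF0, hF0D⟩ := hfam
    obtain ⟨Θ, _, W, G, hG, hGc, hGf⟩ := step_b n _ W0 F0 hF0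
    have hGx : ∀ θ, Def L M (G θ) := fun θ =>
      Def.comp2 (P := fun (u : Θ) (v : Fin n → M) => G u v) hG.dS (DMap.const θ) DMap.id
    refine ⟨{X | (univ : Set M).Definable L X ∧ QQ W G (fun x => x ∈ X)}, ⟨fun X h => h.1, ?_, ?_, ?_, ?_⟩, ?_, ?_⟩
    · rintro ⟨-, h⟩
      obtain ⟨x, hx⟩ := h.ne hG
      exact hx
    · rintro X ⟨h1, h2⟩ Y ⟨h3, h4⟩
      exact ⟨h1.inter h3, h2.and hG h4⟩
    · rintro X ⟨h1, h2⟩ Y h3 h4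
      exact ⟨h3, h2.up fun x hx => h4 hx⟩
    · intro X hX
      rcases hGc (fun x => x ∈ X) hX with h | h
      · exact Or.inl ⟨hX, h⟩
      · exact Or.inr ⟨hX.compl, h⟩
    · intro X hX
      refine ⟨hSdef X hX, ?_⟩
      obtain ⟨Y, hY, hYX⟩ := hfin X hX
      obtain ⟨u, hu, huY⟩ := hF0D Y hY
      exact (hGf u hu).up fun x hx => hYX (huY x hx)
    · refine ⟨_, isDefFamily_of hG.dW hG.dS, ?_, ⟨?_, ?_⟩, ?_⟩
      · rintro _ ⟨θ, hθ, rfl⟩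
        exact ⟨hGx θ, QQ.self hθ⟩
      · rintro ⟨θ, hθ, he⟩
        obtain ⟨x, hx⟩ := hG.ne θ hθ
        have : x ∈ (∅ : Set (Fin n → M)) := he ▸ hx
        exact this
      · rintro _ ⟨θ, hθ, rfl⟩ _ ⟨θ', hθ', rfl⟩
        obtain ⟨θ'', e1, e2⟩ := hG.dir θ θ' hθ hθ'
        exact ⟨_, ⟨θ'', e1, rfl⟩, e2⟩
      · rintro Y ⟨-, θ, h1, h2⟩
        exact ⟨_, ⟨θ, h1, rfl⟩, h2⟩
  have h31 : (∃ p, IsTypeOn L n p ∧ S ⊆ p ∧ HasDefBasis L (Set.univ : Set M) n p) →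
      (∃ p, IsTypeOn L n p ∧ IsDefTypeOver L (Set.univ : Set M) n p ∧ S ⊆ p) := by
    rintro ⟨p, hp, hSp, B, hB, hBp, hBd, hBb⟩
    refine ⟨p, hp, ?_, hSp⟩
    intro k E hE
    obtain ⟨m, Ω, D, hΩ, hD, rfl⟩ := hB
    have hE' := def_sum (hE.mono (empty_subset (univ : Set M)))
    have hD' := def_sum hD
    have hΩ' : Def L M (fun u : Fin m → M => u ∈ Ω) := hΩ
    have h : Def L M (fun u : Fin k → M => ∃ b : Fin m → M, b ∈ Ω ∧ ∀ x : Fin n → M, Sum.elim b x ∈ D → Sum.elim u x ∈ E) := by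
      refine Def.ex (Def.and (hΩ'.comp dmap_snd) (Def.all (Def.imp ?_ ?_)))
      · exact Def.comp2 (P := fun (b : Fin m → M) (x : Fin n → M) => Sum.elim b x ∈ D) hD' autodef autodef
      · exact Def.comp2 (P := fun (b : Fin k → M) (x : Fin n → M) => Sum.elim b x ∈ E) hE' autodef autodef
    have h2 := h.congr (Q := fun u : Fin k → M => famFiber E u ∈ p) (by
      intro u
      constructor
      · rintro ⟨b, hb, hsub⟩
        refine hp.2.2.2.1 _ (hBp ⟨b, hb, rfl⟩) _ ?_ (fun x hx => hsub x hx)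
        exact Def.comp2 (P := fun (u : Fin k → M) (v : Fin n → M) => Sum.elim u v ∈ E) hE' (DMap.const u) DMap.id
      · intro hu
        obtain ⟨_, ⟨b, hb, rfl⟩, hsub⟩ := hBb _ hu
        exact ⟨b, hb, fun x hx => hsub hx⟩)
    exact h2
  exact ⟨⟨h12, fun h => h31 (h23 h)⟩, ⟨h23, fun h => h12 (h31 h)⟩⟩
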